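/- arXiv:1302.0982 — 7 statements merged into one kernel-verified Lean document; each statement's English description precedes it below -/
import Mathlib

section
/- Let p ≥ 1, s ≥ 2, k ≥ 2, and q ≥ s−1 be integers. Then the rewriting system on the three-letter alphabet {a,b,x} with rules: a^p x b^q x b^{s−1} → x; a^p b → x b^q x (b^{q+s−1} x)^{k−2}; x b^q x (b^{q+s−1} x)^{k−1} → b; x b^q x (b^{q+s−1} x)^{k−2} b^{q+s} → b^{q+1} x (b^{q+s−1} x)^{k−1}; a^p x b^{q+1} → x b^{q−(s−1)} x (b^{q+s−1} x)^{k−1}, is confluent and terminating, and the monoid it presents is isomorphic to Mon⟨a,b : a^p b^{q+s} a^{pk} b^s = b⟩. -/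
open Relation FreeMonoid

/-- Words over the alphabet `A`: the free monoid on `A`. -/
abbrev Word (A : Type) : Type := FreeMonoid A

/-- One-step rewriting relation of the rewriting system `R`. -/
def OneStep {A : Type} (R : Set (Word A × Word A)) (x y : Word A) : Prop :=
  ∃ u v l r : Word A, (l, r) ∈ R ∧ x = u * l * v ∧ y = u * r * v

/-- Confluence of the rewriting system `R`. -/
def IsConfluent {A : Type} (R : Set (Word A × Word A)) : Prop :=
  ∀ w x y : Word A, ReflTransGen (OneStep R) w x → ReflTransGen (OneStep R) w y →
    ∃ z : Word A, ReflTransGen (OneStep R) x z ∧ ReflTransGen (OneStep R) y z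

/-- Termination of the rewriting system `R`: no infinite rewriting chain. -/
def IsTerminating {A : Type} (R : Set (Word A × Word A)) : Prop :=
  ¬ ∃ f : ℕ → Word A, ∀ n : ℕ, OneStep R (f n) (f (n + 1))

/-- The monoid presented by generators `A` and relations `R`: the quotient of the
free monoid on `A` by the congruence generated by `R`. -/
abbrev MonPres {A : Type} (R : Set (Word A × Word A)) : Type :=
  (conGen fun x y : Word A => (x, y) ∈ R).Quotient

/-- The canonical projection from words to the presented monoid. -/
def presMk {A : Type} (R : Set (Word A × Word A)) : Word A →* MonPres R :=
  Con.mk' _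

/-- A two-letter alphabet. -/
inductive AB : Type | a | b

/-- A three-letter alphabet. -/
inductive ABX : Type | a | b | x


local notation "𝕒" => FreeMonoid.of ABX.a
local notation "𝕓" => FreeMonoid.of ABX.b
local notation "𝕩" => FreeMonoid.of ABX.x

/-- Two words are joinable when they have a common descendant. -/
abbrev Joinable {A : Type} (R : Set (Word A × Word A)) : Word A → Word A → Prop :=
  Join (ReflTransGen (OneStep R))

theorem OneStep.mul_left {A : Type} {R : Set (Word A × Word A)} {y z : Word A} (u : Word A)
    (h : OneStep R y z) : OneStep R (u * y) (u * z) := by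
  obtain ⟨u', v, l, r, hR, rfl, rfl⟩ := h
  exact ⟨u * u', v, l, r, hR, by simp only [mul_assoc], by simp only [mul_assoc]⟩

theorem Joinable.mul_left {A : Type} {R : Set (Word A × Word A)} {y z : Word A} (u : Word A)
    (h : Joinable R y z) : Joinable R (u * y) (u * z) := by
  obtain ⟨w, hy, hz⟩ := h
  exact ⟨u * w, ReflTransGen.lift (u * ·) (fun _ _ => OneStep.mul_left u) _ _ hy,
    ReflTransGen.lift (u * ·) (fun _ _ => OneStep.mul_left u) _ _ hz⟩

theorem Joinable.symm {A : Type} {R : Set (Word A × Word A)} {y z : Word A}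
    (h : Joinable R y z) : Joinable R z y := by
  obtain ⟨w, hy, hz⟩ := h
  exact ⟨w, hz, hy⟩

theorem OneStep.of_mem {A : Type} {R : Set (Word A × Word A)} {l r : Word A} (h : (l, r) ∈ R)
    (u v : Word A) : OneStep R (u * (l * v)) (u * (r * v)) :=
  ⟨u, v, l, r, h, by rw [mul_assoc], by rw [mul_assoc]⟩

theorem OneStep.of_mem_prefix {A : Type} {R : Set (Word A × Word A)} {l r : Word A}
    (h : (l, r) ∈ R) (v : Word A) : OneStep R (l * v) (r * v) :=
  ⟨1, v, l, r, h, by rw [one_mul], by rw [one_mul]⟩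

/-- A system whose steps decrease a natural-number measure is terminating. -/
theorem IsTerminating.of_measure {A : Type} {R : Set (Word A × Word A)} (μ : Word A → ℕ)
    (hμ : ∀ y z, OneStep R y z → μ z < μ y) : IsTerminating R := by
  rintro ⟨f, hf⟩
  exact not_strictAnti_of_wellFoundedLT (fun n => μ (f n))
    (strictAnti_nat_of_succ_lt fun n => hμ _ _ (hf n))

/-- Newman's lemma, for a system whose steps decrease a natural-number measure. -/
theorem IsConfluent.of_measure {A : Type} {R : Set (Word A × Word A)} (μ : Word A → ℕ)
    (hμ : ∀ y z, OneStep R y z → μ z < μ y)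
    (hR : ∀ w y z, OneStep R w y → OneStep R w z → Joinable R y z) : IsConfluent R := by
  intro w
  induction hn : μ w using Nat.strong_induction_on generalizing w with
  | _ n ih =>
    subst hn
    intro y z hy hz
    rcases hy.cases_head with rfl | ⟨y', hwy, hy⟩
    · exact ⟨z, hz, .refl⟩
    rcases hz.cases_head with rfl | ⟨z', hwz, hz⟩
    · exact ⟨y, .refl, .head hwy hy⟩
    obtain ⟨t, hyt, hzt⟩ := hR w y' z' hwy hwz
    obtain ⟨c, hyc, htc⟩ := ih _ (hμ _ _ hwy) y' rfl y t hy hyt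
    obtain ⟨e, hce, hze⟩ := ih _ (hμ _ _ hwz) z' rfl c z (hzt.trans htc) hz
    exact ⟨e, hyc.trans hce, hze⟩

/-- Local confluence follows from joinability of overlapping left-hand sides. -/
theorem joinable_of_overlaps {A : Type} {R : Set (Word A × Word A)}
    (h : ∀ l₁ r₁ l₂ r₂ v₁ v₂ t : Word A, (l₁, r₁) ∈ R → (l₂, r₂) ∈ R →
      l₁ * v₁ = t * (l₂ * v₂) → Joinable R (r₁ * v₁) (t * (r₂ * v₂)))
    (w y z : Word A) (hy : OneStep R w y) (hz : OneStep R w z) : Joinable R y z := by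
  obtain ⟨u₁, v₁, l₁, r₁, h₁, rfl, rfl⟩ := hy
  obtain ⟨u₂, v₂, l₂, r₂, h₂, he, rfl⟩ := hz
  rw [mul_assoc, mul_assoc] at he
  simp only [mul_assoc]
  have key : (∃ t, u₂ = u₁ * t ∧ l₁ * v₁ = t * (l₂ * v₂)) ∨
      ∃ t, u₁ = u₂ * t ∧ l₂ * v₂ = t * (l₁ * v₁) :=
    List.append_eq_append_iff.1 he
  obtain ⟨t, rfl, ht⟩ | ⟨t, rfl, ht⟩ := key
  · rw [mul_assoc]
    exact (h _ _ _ _ _ _ _ h₁ h₂ ht).mul_left _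
  · rw [mul_assoc]
    exact ((h _ _ _ _ _ _ _ h₂ h₁ ht).mul_left _).symm

section Peeling

variable {A : Type} {c e : A} {t v w z : Word A}

theorem of_mul_eq_of_mul : of c * w = of e * z ↔ c = e ∧ w = z :=
  List.cons_eq_cons

theorem of_mul_eq_mul (h : of c * w = t * z) :
    t = 1 ∨ ∃ t', t = of c * t' ∧ w = t' * z := by
  induction t using FreeMonoid.casesOn with
  | one => exact .inl rfl
  | of_mul e t =>
    rw [mul_assoc, of_mul_eq_of_mul] at h
    obtain ⟨rfl, rfl⟩ := h
    exact .inr ⟨t, rfl, rfl⟩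

/-- If a prefix `c ^ i` is followed by a letter other than `c`, then no longer power of `c`
is a prefix. -/
theorem le_of_pow_mul_of_eq_pow_mul (hec : e ≠ c) {i j : ℕ}
    (h : of c ^ i * (of e * w) = of c ^ j * z) : j ≤ i := by
  induction j generalizing i with
  | zero => exact Nat.zero_le _
  | succ j ih =>
    cases i with
    | zero =>
      rw [pow_succ', mul_assoc, pow_zero, one_mul, of_mul_eq_of_mul] at h
      exact absurd h.1 hec
    | succ i =>
      rw [pow_succ', pow_succ', mul_assoc, mul_assoc, of_mul_eq_of_mul] at h
      exact Nat.succ_le_succ (ih h.2)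

/-- An occurrence of `c ^ n` in a word starting with `c ^ n * e`, where `e ≠ c`, is either that
prefix or starts after the letter `e`. -/
theorem pow_mul_of_eq_mul_pow (hec : e ≠ c) {n : ℕ}
    (h : of c ^ n * (of e * w) = t * (of c ^ n * z)) :
    t = 1 ∨ ∃ t', t = of c ^ n * (of e * t') ∧ w = t' * (of c ^ n * z) := by
  suffices H : ∀ i, of c ^ i * (of e * w) = t * (of c ^ n * z) → i ≤ n →
      (t = 1 ∧ i = n) ∨ ∃ t', t = of c ^ i * (of e * t') ∧ w = t' * (of c ^ n * z) by
    rcases H n h le_rfl with h | h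
    exacts [.inl h.1, .inr h]
  clear h
  intro i
  induction i generalizing t with
  | zero =>
    intro h hi
    have h₀ := h
    rw [pow_zero, one_mul] at h₀
    rcases of_mul_eq_mul h₀ with rfl | ⟨t, rfl, h'⟩
    · rw [one_mul] at h
      exact .inl ⟨rfl, hi.antisymm (le_of_pow_mul_of_eq_pow_mul hec h)⟩
    · exact .inr ⟨t, by rw [pow_zero, one_mul], h'⟩
  | succ i ih =>
    intro h hi
    have h₀ := h
    rw [pow_succ', mul_assoc] at h₀
    rcases of_mul_eq_mul h₀ with rfl | ⟨t, rfl, h'⟩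
    · rw [one_mul] at h
      exact .inl ⟨rfl, hi.antisymm (le_of_pow_mul_of_eq_pow_mul hec h)⟩
    · rcases ih h' (by omega) with ⟨rfl, rfl⟩ | ⟨t, rfl, h₁⟩
      · omega
      · exact .inr ⟨t, by simp only [pow_succ', mul_assoc], h₁⟩

/-- No occurrence of the word `z` starts inside a prefix `u`. -/
def Skips (u z : Word A) : Prop :=
  ∀ t w, u * w = t * z → ∃ t', t = u * t' ∧ w = t' * z

theorem Skips.of_ne (h : c ≠ e) : Skips (of c) (of e * z) := by
  intro t w hw
  rcases of_mul_eq_mul hw with rfl | h'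
  · rw [one_mul, of_mul_eq_of_mul] at hw
    exact absurd hw.1 h
  · exact h'

theorem Skips.mul {u u' : Word A} (hu : Skips u z) (hu' : Skips u' z) : Skips (u * u') z := by
  intro t w h
  rw [mul_assoc] at h
  obtain ⟨t, rfl, h₁⟩ := hu _ _ h
  obtain ⟨t, rfl, h₂⟩ := hu' _ _ h₁
  exact ⟨t, by rw [mul_assoc], h₂⟩

theorem Skips.pow {u : Word A} (hu : Skips u z) (n : ℕ) : Skips (u ^ n) z := by
  induction n with
  | zero => exact fun t w h => ⟨t, by rw [pow_zero, one_mul], by rwa [pow_zero, one_mul] at h⟩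
  | succ n ih => rw [pow_succ]; exact ih.mul hu

end Peeling

theorem joinable_of_disjoint {A : Type} {R : Set (Word A × Word A)} {l₁ r₁ l₂ r₂ : Word A}
    (h₁ : (l₁, r₁) ∈ R) (h₂ : (l₂, r₂) ∈ R) (t v : Word A) :
    Joinable R (r₁ * (t * (l₂ * v))) (l₁ * t * (r₂ * v)) := by
  refine ⟨r₁ * (t * (r₂ * v)), .single ?_, .single ?_⟩
  · rw [← mul_assoc r₁, ← mul_assoc r₁]
    exact .of_mem h₂ _ _
  · rw [mul_assoc]
    exact .of_mem_prefix h₁ _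

theorem Skips.joinable {A : Type} {R : Set (Word A × Word A)} {l₁ r₁ l₂ r₂ v₁ v₂ t : Word A}
    (hl : Skips l₁ (l₂ * v₂)) (h₁ : (l₁, r₁) ∈ R) (h₂ : (l₂, r₂) ∈ R)
    (h : l₁ * v₁ = t * (l₂ * v₂)) : Joinable R (r₁ * v₁) (t * (r₂ * v₂)) := by
  obtain ⟨t, rfl, rfl⟩ := hl _ _ h
  exact joinable_of_disjoint h₁ h₂ t v₂

/-- The word `x b ^ (q + s - 1)`, where `s = σ + 1` and `q = d + σ`. -/
def xBlock (σ d : ℕ) : Word ABX := 𝕩 * 𝕓 ^ (d + σ + σ)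

/-- The five rules of the system, with `s = σ + 1`, `q = d + σ` and `k = n + 2`. -/
inductive Rule (p σ d n : ℕ) : Word ABX → Word ABX → Prop
  | axbxb : Rule p σ d n (𝕒 ^ p * (𝕩 * (𝕓 ^ (d + σ) * (𝕩 * 𝕓 ^ σ)))) 𝕩
  | ab : Rule p σ d n (𝕒 ^ p * 𝕓) (𝕩 * (𝕓 ^ (d + σ) * (xBlock σ d ^ n * 𝕩)))
  | xbx : Rule p σ d n (𝕩 * (𝕓 ^ (d + σ) * (xBlock σ d ^ (n + 1) * 𝕩))) 𝕓
  | xbb : Rule p σ d n (𝕩 * (𝕓 ^ (d + σ) * (xBlock σ d ^ (n + 1) * 𝕓)))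
      (𝕓 ^ (d + σ + 1) * (xBlock σ d ^ (n + 1) * 𝕩))
  | axb : Rule p σ d n (𝕒 ^ p * (𝕩 * 𝕓 ^ (d + σ + 1))) (𝕩 * (𝕓 ^ d * (xBlock σ d ^ (n + 1) * 𝕩)))

/-- The system consisting of the rules `Rule`. -/
def ruleSet (p σ d n : ℕ) : Set (Word ABX × Word ABX) := {z | Rule p σ d n z.1 z.2}

section Confluence

variable {p σ d n : ℕ}

theorem xBlock_pow_succ (j : ℕ) (w : Word ABX) :
    xBlock σ d ^ (j + 1) * w = 𝕩 * (𝕓 ^ (d + σ) * (𝕓 ^ σ * (xBlock σ d ^ j * w))) := by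
  rw [pow_succ', mul_assoc, xBlock, mul_assoc, pow_add _ (d + σ), mul_assoc]

theorem skips_xBlock (hσ : 1 ≤ σ) (z : Word ABX) :
    Skips (xBlock σ d) (𝕩 * (𝕓 ^ (d + σ) * (𝕩 * z))) := by
  intro t w h
  rw [xBlock, mul_assoc] at h
  rcases of_mul_eq_mul h with rfl | ⟨t, rfl, h₁⟩
  · rw [one_mul, of_mul_eq_of_mul] at h
    have := le_of_pow_mul_of_eq_pow_mul (by simp) h.2.symm
    omega
  · obtain ⟨t, rfl, h₂⟩ := (Skips.of_ne (by simp)).pow _ _ _ h₁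
    exact ⟨t, by rw [xBlock, mul_assoc], h₂⟩

theorem pow_b_mul_b (j : ℕ) (w : Word ABX) : 𝕓 ^ j * (𝕓 * w) = 𝕓 ^ (j + 1) * w := by
  rw [pow_succ, mul_assoc]

theorem b_mul_pow_b (j : ℕ) (w : Word ABX) : 𝕓 * (𝕓 ^ j * w) = 𝕓 ^ (j + 1) * w := by
  rw [pow_succ', mul_assoc]

/-- The overlap of two words starting with `a ^ p`. -/
theorem joinable_of_a_prefix {c : ABX} (hc : c ≠ ABX.a) {l r l' r' v v' t : Word ABX}
    (hl : ∀ z, Skips l (𝕒 * z)) (hp : 1 ≤ p)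
    (h : Rule p σ d n (𝕒 ^ p * (of c * l)) r) (h' : Rule p σ d n (𝕒 ^ p * l') r')
    (he : 𝕒 ^ p * (of c * l) * v = t * (𝕒 ^ p * l' * v'))
    (h1 : of c * (l * v) = l' * v' → Joinable (ruleSet p σ d n) (r * v) (r' * v')) :
    Joinable (ruleSet p σ d n) (r * v) (t * (r' * v')) := by
  simp only [mul_assoc] at he
  rcases pow_mul_of_eq_mul_pow hc he with rfl | ⟨t, rfl, he'⟩
  · rw [one_mul] at he ⊢
    exact h1 (mul_left_cancel he)
  · clear he
    obtain ⟨j, rfl⟩ := Nat.exists_eq_add_of_le' hp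
    simp only [pow_succ' _ j, mul_assoc] at he'
    obtain ⟨t, rfl, rfl⟩ := hl _ _ _ he'
    have := joinable_of_disjoint (R := ruleSet (j + 1) σ d n) h h' t v'
    simpa only [mul_assoc, pow_succ' _ j] using this

theorem skips_a {u : Word ABX} (hu : ∀ z, Skips u (𝕒 * z)) (hp : 1 ≤ p) (l v : Word ABX) :
    Skips u (𝕒 ^ p * l * v) := by
  obtain ⟨j, rfl⟩ := Nat.exists_eq_add_of_le' hp
  rw [pow_succ', mul_assoc, mul_assoc]
  exact hu _

theorem OneStep.of_rule {l r : Word ABX} (h : Rule p σ d n l r) (u v : Word ABX) {y z : Word ABX}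
    (hy : y = u * (l * v)) (hz : z = u * (r * v)) : OneStep (ruleSet p σ d n) y z := by
  subst hy hz
  exact .of_mem h u v

theorem joinable_of_disjoint_rules {l₁ r₁ l₂ r₂ : Word ABX} (h₁ : Rule p σ d n l₁ r₁)
    (h₂ : Rule p σ d n l₂ r₂) (t v : Word ABX) :
    Joinable (ruleSet p σ d n) (r₁ * (t * (l₂ * v))) (l₁ * t * (r₂ * v)) :=
  joinable_of_disjoint h₁ h₂ t v

theorem skips_xb_a (c : ABX) (hc : c ≠ ABX.a) (z : Word ABX) :
    Skips (𝕩 * (𝕓 ^ (d + σ) * (xBlock σ d ^ (n + 1) * of c))) (𝕒 * z) :=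
  have hx : Skips 𝕩 (𝕒 * z) := .of_ne (by simp)
  have hb : Skips 𝕓 (𝕒 * z) := .of_ne (by simp)
  hx.mul ((hb.pow _).mul (((hx.mul (hb.pow _)).pow _).mul (.of_ne hc)))

/-- The right-hand side of the rule with left-hand side `x b^q (xBlock)^(n+1) c`. -/
def xbRhs (σ d n : ℕ) : ABX → Word ABX
  | .x => 𝕓
  | .b => 𝕓 ^ (d + σ + 1) * (xBlock σ d ^ (n + 1) * 𝕩)
  | .a => 1

theorem Rule.xb {c : ABX} (hc : c ≠ ABX.a) :
    Rule p σ d n (𝕩 * (𝕓 ^ (d + σ) * (xBlock σ d ^ (n + 1) * of c))) (xbRhs σ d n c) := by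
  cases c with
  | a => exact absurd rfl hc
  | b => exact .xbb
  | x => exact .xbx

/-- The critical pairs of `axbxb` with `xbx` and `xbb`, for the longer overlap. -/
theorem joinable_axbxb_long {c : ABX} (hc : c ≠ ABX.a) (v : Word ABX) :
    Joinable (ruleSet p σ d n) (𝕩 * (𝕓 ^ (d + σ) * (xBlock σ d ^ n * (of c * v))))
      (𝕒 ^ p * (xbRhs σ d n c * v)) := by
  cases c with
  | a => exact absurd rfl hc
  | x =>
    exact ⟨_, .refl, .single (.of_rule .ab 1 v (by simp only [xbRhs, mul_assoc, one_mul])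
      (by simp only [mul_assoc, one_mul]))⟩
  | b =>
    refine ⟨_, .refl, .head (.of_rule .ab 1
      (𝕓 ^ (d + σ) * (xBlock σ d ^ (n + 1) * (𝕩 * v))) ?_ rfl) (.single (.of_rule .xbx
      (𝕩 * (𝕓 ^ (d + σ) * xBlock σ d ^ n)) v ?_ ?_))⟩ <;>
    simp only [xbRhs, mul_assoc, one_mul, b_mul_pow_b]

/-- The critical pairs of `axbxb` with `xbx` and `xbb`, for the shorter overlap. -/
theorem joinable_axbxb_short {c : ABX} (hc : c ≠ ABX.a) (v : Word ABX) :
    Joinable (ruleSet p σ d n) (𝕩 * (𝕓 ^ d * (xBlock σ d ^ (n + 1) * (of c * v))))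
      (𝕒 ^ p * (𝕩 * (𝕓 ^ (d + σ) * (xbRhs σ d n c * v)))) := by
  cases c with
  | a => exact absurd rfl hc
  | x =>
    refine ⟨_, .refl, .single (.of_rule .axb 1 v ?_ ?_)⟩ <;>
    simp only [xbRhs, mul_assoc, one_mul, pow_b_mul_b]
  | b =>
    refine ⟨_, .refl, .head (.of_rule .axb 1
      (𝕓 ^ (d + σ) * (xBlock σ d ^ (n + 1) * (𝕩 * v))) ?_ rfl) (.single (.of_rule .xbx
      (𝕩 * (𝕓 ^ d * xBlock σ d ^ (n + 1))) v ?_ ?_))⟩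
    · simp only [xbRhs, mul_assoc, one_mul]
      rw [← b_mul_pow_b (d + σ), ← pow_b_mul_b (d + σ)]
    all_goals simp only [mul_assoc, one_mul]

/-- The overlap of the last letter of `xbx` with `xbx` and `xbb`. -/
theorem joinable_xbx {c : ABX} (hc : c ≠ ABX.a) (v : Word ABX) :
    Joinable (ruleSet p σ d n) (𝕓 * (𝕓 ^ (d + σ) * (xBlock σ d ^ (n + 1) * (of c * v))))
      (𝕩 * (𝕓 ^ (d + σ) * (xBlock σ d ^ (n + 1) * (xbRhs σ d n c * v)))) := by
  cases c with
  | a => exact absurd rfl hc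
  | x =>
    refine ⟨_, .refl, .single (.of_rule .xbb 1 v ?_ ?_)⟩ <;>
    simp only [xbRhs, mul_assoc, one_mul, b_mul_pow_b]
  | b =>
    refine ⟨_, .refl, .head (.of_rule .xbb 1
      (𝕓 ^ (d + σ) * (xBlock σ d ^ (n + 1) * (𝕩 * v))) ?_ rfl) (.single (.of_rule .xbx
      (𝕓 ^ (d + σ + 1) * xBlock σ d ^ (n + 1)) v ?_ ?_))⟩ <;>
    simp only [xbRhs, mul_assoc, one_mul, b_mul_pow_b]

/-- The overlap of the left-hand side of any rule with that of `xbx` or `xbb`. -/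
theorem joinable_xb (hσ : 1 ≤ σ) {c : ABX} (hc : c ≠ ABX.a) {l r v v' t : Word ABX}
    (h : Rule p σ d n l r)
    (he : l * v = t * (𝕩 * (𝕓 ^ (d + σ) * (xBlock σ d ^ (n + 1) * of c)) * v')) :
    Joinable (ruleSet p σ d n) (r * v) (t * (xbRhs σ d n c * v')) := by
  have hR : Rule p σ d n _ _ := Rule.xb hc
  have hz : 𝕩 * (𝕓 ^ (d + σ) * (xBlock σ d ^ (n + 1) * of c)) * v' =
      𝕩 * (𝕓 ^ (d + σ) * (𝕩 * (𝕓 ^ (d + σ) * (𝕓 ^ σ * (xBlock σ d ^ n * (of c * v')))))) := by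
    simp only [mul_assoc, xBlock_pow_succ]
  set z := 𝕩 * (𝕓 ^ (d + σ) * (xBlock σ d ^ (n + 1) * of c)) * v' with hz_def
  have ha : Skips 𝕒 z := by rw [hz]; exact .of_ne (by simp)
  have hb : Skips 𝕓 z := by rw [hz]; exact .of_ne (by simp)
  have hC : Skips (xBlock σ d) z := by rw [hz]; exact skips_xBlock hσ _
  have key : ∀ c', 𝕩 * (𝕓 ^ (d + σ) * (xBlock σ d ^ (n + 1) * of c')) * v = t * z →
      (t = 1 ∧ c' = c ∧ v = v') ∨
      ∃ t', t = 𝕩 * (𝕓 ^ (d + σ) * (xBlock σ d ^ (n + 1) * t')) ∧ of c' * v = t' * z := by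
    intro c' he
    have he' := he
    simp only [mul_assoc] at he'
    rcases of_mul_eq_mul he' with rfl | ⟨t, rfl, he₁⟩
    · rw [one_mul, hz_def] at he
      simp only [mul_assoc, mul_right_inj, of_mul_eq_of_mul] at he
      exact .inl ⟨rfl, he⟩
    · obtain ⟨t, rfl, he₂⟩ := hb.pow _ _ _ he₁
      obtain ⟨t, rfl, he₃⟩ := hC.pow _ _ _ he₂
      exact .inr ⟨t, rfl, he₃⟩
  cases h with
  | axbxb =>
    have he' := he
    simp only [mul_assoc] at he'
    obtain ⟨t, rfl, he₁⟩ := ha.pow _ _ _ he'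
    clear he he'
    rcases of_mul_eq_mul he₁ with rfl | ⟨t, rfl, he₂⟩
    · rw [one_mul, hz] at he₁
      simp only [mul_right_inj] at he₁
      have : v = 𝕓 ^ (d + σ) * (xBlock σ d ^ n * (of c * v')) := by
        rw [← mul_assoc, ← pow_add, add_comm (d + σ), pow_add, mul_assoc] at he₁
        exact mul_left_cancel he₁
      rw [this, mul_one]
      exact joinable_axbxb_long hc v'
    · clear he₁
      obtain ⟨t, rfl, he₃⟩ := hb.pow _ _ _ he₂
      clear he₂
      rcases of_mul_eq_mul he₃ with rfl | ⟨t, rfl, he₄⟩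
      · rw [one_mul, hz_def, mul_assoc, mul_right_inj, add_comm d, pow_add, mul_assoc, mul_assoc,
          mul_right_inj] at he₃
        rw [he₃, mul_one]
        simpa only [mul_assoc] using joinable_axbxb_short (p := p) (σ := σ) (d := d) (n := n) hc v'
      · clear he₃
        obtain ⟨t, rfl, rfl⟩ := hb.pow _ _ _ he₄
        simpa only [hz_def, mul_assoc] using joinable_of_disjoint_rules Rule.axbxb hR t v'
  | ab => exact ((ha.pow _).mul hb).joinable Rule.ab hR he
  | axb =>
    have he' := he
    simp only [mul_assoc] at he'
    obtain ⟨t, rfl, he₁⟩ := ha.pow _ _ _ he'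
    clear he he'
    rcases of_mul_eq_mul he₁ with rfl | ⟨t, rfl, he₂⟩
    · rw [one_mul, hz, mul_right_inj] at he₁
      have := le_of_pow_mul_of_eq_pow_mul (by simp) he₁.symm
      omega
    · clear he₁
      obtain ⟨t, rfl, rfl⟩ := hb.pow _ _ _ he₂
      simpa only [hz_def, mul_assoc] using joinable_of_disjoint_rules Rule.axb hR t v'
  | xbx =>
    rcases key _ he with ⟨rfl, rfl, rfl⟩ | ⟨t, rfl, he₁⟩
    · exact ⟨_, .refl, .refl⟩
    clear he
    rcases of_mul_eq_mul he₁ with rfl | ⟨t, rfl, he₂⟩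
    · rw [one_mul, hz_def, mul_assoc, mul_right_inj] at he₁
      rw [he₁, mul_one]
      simpa only [mul_assoc] using joinable_xbx (p := p) (σ := σ) (d := d) (n := n) hc v'
    · rw [he₂]
      simpa only [hz_def, mul_assoc] using joinable_of_disjoint_rules Rule.xbx hR t v'
  | xbb =>
    rcases key _ he with ⟨rfl, rfl, rfl⟩ | ⟨t, rfl, he₁⟩
    · exact ⟨_, .refl, .refl⟩
    · obtain ⟨t, rfl, he₂⟩ := hb _ _ he₁
      rw [he₂]
      simpa only [hz_def, mul_assoc] using joinable_of_disjoint_rules Rule.xbb hR t v'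

theorem joinable_ruleSet (hp : 1 ≤ p) (hσ : 1 ≤ σ) (l₁ r₁ l₂ r₂ v₁ v₂ t : Word ABX)
    (h₁ : Rule p σ d n l₁ r₁) (h₂ : Rule p σ d n l₂ r₂) (he : l₁ * v₁ = t * (l₂ * v₂)) :
    Joinable (ruleSet p σ d n) (r₁ * v₁) (t * (r₂ * v₂)) := by
  have hb : ∀ z, Skips 𝕓 (𝕒 * z) := fun z => .of_ne (by simp)
  have hx : ∀ z, Skips 𝕩 (𝕒 * z) := fun z => .of_ne (by simp)
  have hone : ∀ z, Skips 1 (𝕒 * z : Word ABX) := fun z t w h => ⟨t, by simp, by simpa using h⟩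
  have hab : Rule p σ d n (𝕒 ^ p * (𝕓 * 1)) (𝕩 * (𝕓 ^ (d + σ) * (xBlock σ d ^ n * 𝕩))) := by rw [mul_one]; exact .ab
  have hl₁ : ∀ z, Skips (𝕓 ^ (d + σ) * (𝕩 * 𝕓 ^ σ)) (𝕒 * z) := fun z =>
    ((hb z).pow _).mul ((hx z).mul ((hb z).pow _))
  have hl₂ : ∀ z, Skips (𝕓 ^ (d + σ + 1)) (𝕒 * z) := fun z => (hb z).pow _
  cases h₂ with
  | xbx => exact joinable_xb (c := .x) hσ (by simp) h₁ he
  | xbb => exact joinable_xb (c := .b) hσ (by simp) h₁ he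
  | axbxb =>
    cases h₁ with
    | xbx => exact (skips_a (skips_xb_a .x (by simp)) hp _ _).joinable Rule.xbx Rule.axbxb he
    | xbb => exact (skips_a (skips_xb_a .b (by simp)) hp _ _).joinable Rule.xbb Rule.axbxb he
    | axbxb =>
      refine joinable_of_a_prefix (by simp) hl₁ hp .axbxb .axbxb he fun h => ?_
      simp only [mul_assoc, mul_right_inj] at h
      exact h ▸ ⟨_, .refl, .refl⟩
    | ab =>
      refine joinable_of_a_prefix (by simp) hone hp hab .axbxb (by simpa using he) fun h => ?_
      simp [mul_assoc, of_mul_eq_of_mul] at h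
    | axb =>
      refine joinable_of_a_prefix (by simp) hl₂ hp .axb .axbxb he fun h => ?_
      simp only [mul_assoc, mul_right_inj] at h
      have := le_of_pow_mul_of_eq_pow_mul (by simp) h.symm
      omega
  | ab =>
    cases h₁ with
    | xbx => exact (skips_a (skips_xb_a .x (by simp)) hp _ _).joinable Rule.xbx Rule.ab he
    | xbb => exact (skips_a (skips_xb_a .b (by simp)) hp _ _).joinable Rule.xbb Rule.ab he
    | axbxb =>
      refine joinable_of_a_prefix (by simp) hl₁ hp .axbxb .ab he fun h => ?_
      simp [of_mul_eq_of_mul] at h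
    | ab =>
      refine joinable_of_a_prefix (by simp) hone hp hab .ab (by simpa using he) fun h => ?_
      simp only [one_mul, mul_right_inj] at h
      exact h ▸ ⟨_, .refl, .refl⟩
    | axb =>
      refine joinable_of_a_prefix (by simp) hl₂ hp .axb .ab he fun h => ?_
      simp [of_mul_eq_of_mul] at h
  | axb =>
    cases h₁ with
    | xbx => exact (skips_a (skips_xb_a .x (by simp)) hp _ _).joinable Rule.xbx Rule.axb he
    | xbb => exact (skips_a (skips_xb_a .b (by simp)) hp _ _).joinable Rule.xbb Rule.axb he
    | axbxb =>
      refine joinable_of_a_prefix (by simp) hl₁ hp .axbxb .axb he fun h => ?_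
      simp only [mul_assoc, mul_right_inj] at h
      have := le_of_pow_mul_of_eq_pow_mul (by simp) h
      omega
    | ab =>
      refine joinable_of_a_prefix (by simp) hone hp hab .axb (by simpa using he) fun h => ?_
      simp [mul_assoc, of_mul_eq_of_mul] at h
    | axb =>
      refine joinable_of_a_prefix (by simp) hl₂ hp .axb .axb he fun h => ?_
      simp only [mul_assoc, mul_right_inj] at h
      exact h ▸ ⟨_, .refl, .refl⟩

end Confluence

section Termination

/-- A monotone interpretation of words as functions on the natural numbers. -/
def interp (K : ℕ) : Word ABX →* Function.End ℕ :=
  FreeMonoid.lift fun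
    | .a => fun m => K * (m + 1)
    | .b => fun m => m + 1
    | .x => fun m => 2 * m

variable {p σ d n K : ℕ}

theorem interp_mul (u v : Word ABX) (m : ℕ) : interp K (u * v) m = interp K u (interp K v m) := by
  rw [map_mul]; rfl

theorem interp_a (m : ℕ) : interp K 𝕒 m = K * (m + 1) := rfl

theorem interp_b (m : ℕ) : interp K 𝕓 m = m + 1 := rfl

theorem interp_x (m : ℕ) : interp K 𝕩 m = 2 * m := rfl

theorem interp_one (m : ℕ) : interp K 1 m = m := by
  rw [map_one]; rfl

theorem interp_b_pow (j m : ℕ) : interp K (𝕓 ^ j) m = m + j := by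
  induction j with
  | zero => rw [pow_zero, interp_one, add_zero]
  | succ j ih => rw [pow_succ', interp_mul, ih, interp_b, add_assoc]

theorem interp_xBlock_pow (σ d j : ℕ) :
    ∃ c, ∀ K m, interp K (xBlock σ d ^ j) m = 2 ^ j * m + c := by
  induction j with
  | zero => exact ⟨0, fun K m => by rw [pow_zero, interp_one, pow_zero, one_mul, add_zero]⟩
  | succ j ih =>
    obtain ⟨c, hc⟩ := ih
    refine ⟨2 * (c + (d + σ + σ)), fun K m => ?_⟩
    rw [pow_succ', interp_mul, hc, xBlock, interp_mul, interp_b_pow, interp_x]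
    ring

theorem le_interp_a_pow (hK : 1 ≤ K) (hp : 1 ≤ p) (m : ℕ) :
    K * (m + 1) ≤ interp K (𝕒 ^ p) m := by
  induction p, hp using Nat.le_induction with
  | base => rw [pow_one, interp_a]
  | succ p _ ih =>
    rw [pow_succ', interp_mul, interp_a]
    nlinarith

theorem interp_strictMono (hK : 1 ≤ K) (u : Word ABX) : StrictMono (interp K u) := by
  induction u using FreeMonoid.inductionOn' with
  | one => exact fun y z h => by rwa [interp_one, interp_one]
  | of_mul c u ih =>
    intro y z h
    have := ih h
    rw [interp_mul, interp_mul]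
    cases c with
    | a =>
      rw [interp_a, interp_a]
      exact Nat.mul_lt_mul_of_pos_left (by omega) hK
    | b => rw [interp_b, interp_b]; omega
    | x => rw [interp_x, interp_x]; omega

theorem exists_interp_lt (hp : 1 ≤ p) (hσ : 1 ≤ σ) :
    ∃ K, 1 ≤ K ∧ ∀ l r, Rule p σ d n l r → ∀ m, interp K r m < interp K l m := by
  obtain ⟨c, hc⟩ := interp_xBlock_pow σ d n
  obtain ⟨e, he⟩ := interp_xBlock_pow σ d (n + 1)
  have h1 : 1 ≤ 2 ^ n := Nat.one_le_two_pow
  have hK : 1 ≤ 8 * 2 ^ n + 2 * (c + e + d + σ) + 1 := by omega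
  refine ⟨8 * 2 ^ n + 2 * (c + e + d + σ) + 1, hK, fun l r h m => ?_⟩
  have ha := le_interp_a_pow hK hp
  cases h <;> simp only [interp_mul, interp_b_pow, hc, he, interp_b, interp_x, pow_succ 2 n]
  · refine lt_of_lt_of_le ?_ (ha _)
    nlinarith
  · refine lt_of_lt_of_le ?_ (ha _)
    nlinarith
  · nlinarith
  · nlinarith
  · refine lt_of_lt_of_le ?_ (ha _)
    nlinarith

theorem exists_measure_ruleSet (hp : 1 ≤ p) (hσ : 1 ≤ σ) :
    ∃ μ : Word ABX → ℕ, ∀ y z, OneStep (ruleSet p σ d n) y z → μ z < μ y := by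
  obtain ⟨K, hK, h⟩ := exists_interp_lt (d := d) (n := n) hp hσ
  refine ⟨fun w => interp K w 0, ?_⟩
  rintro _ _ ⟨u, v, l, r, hR, rfl, rfl⟩
  simp only [interp_mul]
  exact interp_strictMono hK u (h l r hR _)

end Termination

section Presentation

/-- The homomorphism out of a presented monoid given by images of the generators that satisfy the
relations. -/
def MonPres.lift {A M : Type} [Monoid M] {R : Set (Word A × Word A)} (f : A → M)
    (hf : ∀ l r, (l, r) ∈ R → FreeMonoid.lift f l = FreeMonoid.lift f r) : MonPres R →* M :=
  Con.lift _ (FreeMonoid.lift f) (Con.conGen_le.2 hf)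

theorem MonPres.lift_presMk {A M : Type} [Monoid M] {R : Set (Word A × Word A)} (f : A → M)
    (hf : ∀ l r, (l, r) ∈ R → FreeMonoid.lift f l = FreeMonoid.lift f r) (c : A) :
    MonPres.lift f hf (presMk R (of c)) = f c :=
  FreeMonoid.lift_eval_of f c

theorem MonPres.hom_ext {A M : Type} [Monoid M] {R : Set (Word A × Word A)}
    {f g : MonPres R →* M} (h : ∀ c, f (presMk R (of c)) = g (presMk R (of c))) : f = g :=
  Con.hom_ext (FreeMonoid.hom_eq h)

theorem presMk_eq {A : Type} {R : Set (Word A × Word A)} {l r : Word A} (h : (l, r) ∈ R) :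
    presMk R l = presMk R r :=
  (Con.eq _).2 (ConGen.Rel.of _ _ h)

variable {M : Type*} [Monoid M] {p σ d n : ℕ} {A b x : M}

theorem pow_mul_collapse {m : ℕ} (h : A * b ^ (m + 1) * x = b) (i j : ℕ) :
    A ^ (i + j) * (b * (b ^ m * x) ^ j) = A ^ i * b := by
  induction j with
  | zero => simp
  | succ j ih =>
    have h' : A * (b * (b ^ m * x)) = b := by
      rw [← mul_assoc b, ← pow_succ', ← mul_assoc, h]
    calc A ^ (i + (j + 1)) * (b * (b ^ m * x) ^ (j + 1))
        = A ^ (i + j) * (A * (b * (b ^ m * x)) * (b ^ m * x) ^ j) := by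
          rw [← add_assoc, pow_succ, pow_succ' _ j]; simp only [mul_assoc]
      _ = A ^ i * b := by rw [h', ih]

/-- The rules hold in every monoid in which `x` stands for `a^(pk) b^s` and the relation
`a^p b^(q+s) a^(pk) b^s = b` holds. -/
theorem Rule.lift_eq {f : ABX → M} {l r : Word ABX} (hR : Rule p σ d n l r)
    (hx : f .x = (f .a ^ p) ^ (n + 2) * f .b ^ (σ + 1))
    (h : f .a ^ p * f .b ^ (d + σ + σ + 1) * f .x = f .b) :
    FreeMonoid.lift f l = FreeMonoid.lift f r := by
  set A := f .a ^ p with hA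
  set b := f .b
  set x := f .x
  have hblock : ∀ j, (x * b ^ (d + σ + σ)) ^ j * x = x * (b ^ (d + σ + σ) * x) ^ j :=
    fun j => mul_pow_mul _ _ _
  have hxb : ∀ i j, i + j = n + 1 →
      x * (b ^ (d + σ) * ((x * b ^ (d + σ + σ)) ^ j * x)) = A ^ i * b := by
    intro i j hij
    rw [hblock, ← pow_mul_collapse h i j, hij]
    have h1 : A ^ (n + 2) * b ^ (σ + 1) * (b ^ (d + σ) * x) = A ^ (n + 1) * b := by
      rw [← mul_assoc, mul_assoc _ _ (b ^ (d + σ)), ← pow_add, pow_succ A, mul_assoc, mul_assoc,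
        ← mul_assoc A, show σ + 1 + (d + σ) = d + σ + σ + 1 by omega, h]
    calc x * (b ^ (d + σ) * (x * (b ^ (d + σ + σ) * x) ^ j))
        = A ^ (n + 2) * b ^ (σ + 1) * (b ^ (d + σ) * x) * (b ^ (d + σ + σ) * x) ^ j := by
          rw [← hx]; simp only [mul_assoc]
      _ = _ := by rw [h1, mul_assoc]
  have hxbx := hxb 0 (n + 1) (zero_add _)
  rw [pow_zero, one_mul] at hxbx
  have haxbxb : A * (x * (b ^ (d + σ) * (x * b ^ σ))) = x := by
    calc A * (x * (b ^ (d + σ) * (x * b ^ σ)))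
        = A * (x * (b ^ (d + σ) * x)) * b ^ σ := by simp only [mul_assoc]
      _ = A * (A ^ (n + 1) * b) * b ^ σ := by
          have := hxb (n + 1) 0 rfl
          rw [pow_zero, one_mul] at this
          rw [this]
      _ = A ^ (n + 2) * b ^ (σ + 1) := by
          rw [pow_succ' b, pow_succ' A (n + 1)]; simp only [mul_assoc]
      _ = x := hx.symm
  cases hR with
  | axbxb => simpa [← hA] using haxbxb
  | ab =>
    have := hxb 1 n (add_comm _ _)
    rw [pow_one] at this
    simpa [← hA, xBlock] using this.symm
  | xbx => simpa [xBlock] using hxbx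
  | xbb =>
    have key : x * (b ^ (d + σ) * ((x * b ^ (d + σ + σ)) ^ (n + 1) * b)) =
        b ^ (d + σ + 1) * ((x * b ^ (d + σ + σ)) ^ (n + 1) * x) := by
      generalize (x * b ^ (d + σ + σ)) ^ (n + 1) = E at hxbx ⊢
      calc x * (b ^ (d + σ) * (E * b))
          = x * (b ^ (d + σ) * (E * (x * (b ^ (d + σ) * (E * x))))) := by rw [hxbx]
        _ = x * (b ^ (d + σ) * (E * x)) * (b ^ (d + σ) * (E * x)) := by simp only [mul_assoc]
        _ = b ^ (d + σ + 1) * (E * x) := by rw [hxbx, pow_succ', mul_assoc]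
    simpa [xBlock] using key
  | axb =>
    have key : A * (x * b ^ (d + σ + 1)) =
        x * (b ^ d * ((x * b ^ (d + σ + σ)) ^ (n + 1) * x)) := by
      generalize (x * b ^ (d + σ + σ)) ^ (n + 1) = E at hxbx ⊢
      calc A * (x * b ^ (d + σ + 1))
          = A * (x * (b ^ (d + σ) * (x * (b ^ (d + σ) * (E * x))))) := by rw [hxbx, pow_succ]
        _ = A * (x * (b ^ (d + σ) * (x * (b ^ (σ + d) * (E * x))))) := by rw [add_comm σ d]
        _ = A * (x * (b ^ (d + σ) * (x * b ^ σ))) * (b ^ d * (E * x)) := by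
            rw [pow_add b σ d]; simp only [mul_assoc]
        _ = x * (b ^ d * (E * x)) := by rw [haxbxb]
    simpa [xBlock, ← hA] using key

/-- The rules `axbxb`, `ab` and `xbx` express `x` through the other two generators. -/
theorem eq_pow_mul_pow_of_rules
    (haxbxb : A * (x * (b ^ (d + σ) * (x * b ^ σ))) = x)
    (hab : A * b = x * (b ^ (d + σ) * ((x * b ^ (d + σ + σ)) ^ n * x))) :
    A ^ (n + 2) * b ^ (σ + 1) = x := by
  have key : ∀ j, A ^ j * (x * (b ^ (d + σ) * ((x * b ^ (d + σ + σ)) ^ j * (x * b ^ σ)))) =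
      x * (b ^ (d + σ) * (x * b ^ σ)) := by
    intro j
    induction j with
    | zero => simp
    | succ j ih =>
      calc A ^ (j + 1) *
            (x * (b ^ (d + σ) * ((x * b ^ (d + σ + σ)) ^ (j + 1) * (x * b ^ σ))))
          = A ^ j * (A * (x * (b ^ (d + σ) * (x * b ^ σ))) *
              (b ^ (d + σ) * ((x * b ^ (d + σ + σ)) ^ j * (x * b ^ σ)))) := by
            rw [pow_succ, pow_succ' (x * _), add_comm (d + σ) σ, pow_add b σ]
            simp only [mul_assoc]
        _ = _ := by rw [haxbxb, ih]
  calc A ^ (n + 2) * b ^ (σ + 1) = A * (A ^ n * (A * b * b ^ σ)) := by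
        rw [pow_succ' A (n + 1), pow_succ A, pow_succ' b]; simp only [mul_assoc]
    _ = A * (A ^ n * (x * (b ^ (d + σ) * ((x * b ^ (d + σ + σ)) ^ n * (x * b ^ σ))))) := by
        rw [hab]; simp only [mul_assoc]
    _ = x := by rw [key, haxbxb]

theorem mul_pow_mul_eq_of_rules
    (hab : A * b = x * (b ^ (d + σ) * ((x * b ^ (d + σ + σ)) ^ n * x)))
    (hxbx : x * (b ^ (d + σ) * ((x * b ^ (d + σ + σ)) ^ (n + 1) * x)) = b) :
    A * b ^ (d + σ + σ + 1) * x = b := by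
  conv_rhs => rw [← hxbx]
  rw [pow_succ' b (d + σ + σ), ← mul_assoc, hab, pow_succ (x * _)]
  simp only [mul_assoc]

/-- The relation of the two-generator presentation. -/
def relSet (p σ d n : ℕ) : Set (Word AB × Word AB) :=
  {(of AB.a ^ p * of AB.b ^ (d + σ + (σ + 1)) * of AB.a ^ (p * (n + 2)) * of AB.b ^ (σ + 1),
    of AB.b)}

theorem nonempty_mulEquiv (p σ d n : ℕ) :
    Nonempty (MonPres (ruleSet p σ d n) ≃* MonPres (relSet p σ d n)) := by
  let g : AB → MonPres (ruleSet p σ d n)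
    | .a => presMk _ 𝕒
    | .b => presMk _ 𝕓
  let f : ABX → MonPres (relSet p σ d n)
    | .a => presMk _ (of AB.a)
    | .b => presMk _ (of AB.b)
    | .x => (presMk _ (of AB.a) ^ p) ^ (n + 2) * presMk _ (of AB.b) ^ (σ + 1)
  have hrule : ∀ {l r}, Rule p σ d n l r → presMk (ruleSet p σ d n) l = presMk _ r :=
    fun h => presMk_eq h
  have haxbxb := hrule .axbxb
  have hab := hrule .ab
  have hxbx := hrule .xbx
  simp only [map_mul, map_pow, xBlock] at haxbxb hab hxbx
  have hx := eq_pow_mul_pow_of_rules haxbxb hab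
  have hb := mul_pow_mul_eq_of_rules hab hxbx
  have hrel := presMk_eq (R := relSet p σ d n) rfl
  simp only [map_mul, map_pow] at hrel
  have hf : ∀ l r, (l, r) ∈ ruleSet p σ d n → FreeMonoid.lift f l = FreeMonoid.lift f r := by
    intro l r h
    refine Rule.lift_eq h rfl ?_
    simp only [f]
    rw [← pow_mul, ← mul_assoc]
    exact hrel
  have hg : ∀ l r, (l, r) ∈ relSet p σ d n → FreeMonoid.lift g l = FreeMonoid.lift g r := by
    intro l r h
    obtain ⟨rfl, rfl⟩ := Prod.mk.inj h
    simp only [map_mul, map_pow, FreeMonoid.lift_eval_of, g]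
    rw [mul_assoc, pow_mul, hx]
    exact hb
  refine ⟨MonoidHom.toMulEquiv (MonPres.lift f hf) (MonPres.lift g hg) (MonPres.hom_ext ?_)
    (MonPres.hom_ext ?_)⟩
  · rintro (_ | _ | _)
    all_goals
      simp only [MonoidHom.comp_apply, MonPres.lift_presMk, MonoidHom.id_apply, f, map_mul,
        map_pow, g]
    exact hx
  · rintro (_ | _) <;>
      simp only [MonoidHom.comp_apply, MonPres.lift_presMk, MonoidHom.id_apply, f, g]

end Presentation

/-- The rules, written with the words `(b ^ (q + s - 1) * x) ^ j` instead of powers of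
`xBlock`. -/
theorem ruleSet_eq (p σ d n : ℕ) : ruleSet p σ d n =
    {(𝕒 ^ p * 𝕩 * 𝕓 ^ (d + σ) * 𝕩 * 𝕓 ^ σ, 𝕩),
      (𝕒 ^ p * 𝕓, 𝕩 * 𝕓 ^ (d + σ) * 𝕩 * (𝕓 ^ (d + σ + σ) * 𝕩) ^ n),
      (𝕩 * 𝕓 ^ (d + σ) * 𝕩 * (𝕓 ^ (d + σ + σ) * 𝕩) ^ (n + 1), 𝕓),
      (𝕩 * 𝕓 ^ (d + σ) * 𝕩 * (𝕓 ^ (d + σ + σ) * 𝕩) ^ n * 𝕓 ^ (d + σ + (σ + 1)),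
        𝕓 ^ (d + σ + 1) * 𝕩 * (𝕓 ^ (d + σ + σ) * 𝕩) ^ (n + 1)),
      (𝕒 ^ p * 𝕩 * 𝕓 ^ (d + σ + 1),
        𝕩 * 𝕓 ^ d * 𝕩 * (𝕓 ^ (d + σ + σ) * 𝕩) ^ (n + 1))} := by
  have hx : ∀ (w : Word ABX) j,
      w * 𝕩 * (𝕓 ^ (d + σ + σ) * 𝕩) ^ j = w * (xBlock σ d ^ j * 𝕩) := fun w j => by
    rw [mul_assoc, ← mul_pow_mul, xBlock]
  have hb : xBlock σ d ^ n * 𝕩 * 𝕓 ^ (d + σ + (σ + 1)) = xBlock σ d ^ (n + 1) * 𝕓 := by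
    rw [← add_assoc, pow_succ, pow_succ, mul_assoc, mul_assoc, ← mul_assoc 𝕩, xBlock]
  simp only [hx, mul_assoc _ (xBlock σ d ^ n * 𝕩), hb]
  simp only [mul_assoc]
  ext ⟨l, r⟩
  simp only [Set.mem_insert_iff, Set.mem_singleton_iff, Prod.mk.injEq]
  constructor
  · intro h
    cases (show Rule p σ d n l r from h) with
    | axbxb => exact .inl ⟨rfl, rfl⟩
    | ab => exact .inr (.inl ⟨rfl, rfl⟩)
    | xbx => exact .inr (.inr (.inl ⟨rfl, rfl⟩))
    | xbb => exact .inr (.inr (.inr (.inl ⟨rfl, rfl⟩)))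
    | axb => exact .inr (.inr (.inr (.inr ⟨rfl, rfl⟩)))
  · rintro (⟨rfl, rfl⟩ | ⟨rfl, rfl⟩ | ⟨rfl, rfl⟩ | ⟨rfl, rfl⟩ | ⟨rfl, rfl⟩)
    exacts [Rule.axbxb, Rule.ab, Rule.xbx, Rule.xbb, Rule.axb]

/-- Case 4 with `q ≥ s - 1`: the five-rule system on `{a,b,x}` is complete and presents
`Mon⟨a,b : a^p b^(q+s) a^(pk) b^s = b⟩`. -/
theorem stmt6 (p s k q : ℕ) (hp : 1 ≤ p) (hs : 2 ≤ s) (hk : 2 ≤ k) (hq : s - 1 ≤ q) :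
    IsConfluent (({((of ABX.a)^p * (of ABX.x) * (of ABX.b)^q * (of ABX.x) * (of ABX.b)^(s-1), of ABX.x),
       ((of ABX.a)^p * (of ABX.b), (of ABX.x) * (of ABX.b)^q * (of ABX.x) * ((of ABX.b)^(q+s-1) * (of ABX.x))^(k-2)),
       ((of ABX.x) * (of ABX.b)^q * (of ABX.x) * ((of ABX.b)^(q+s-1) * (of ABX.x))^(k-1), of ABX.b),
       ((of ABX.x) * (of ABX.b)^q * (of ABX.x) * ((of ABX.b)^(q+s-1) * (of ABX.x))^(k-2) * (of ABX.b)^(q+s),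
        (of ABX.b)^(q+1) * (of ABX.x) * ((of ABX.b)^(q+s-1) * (of ABX.x))^(k-1)),
       ((of ABX.a)^p * (of ABX.x) * (of ABX.b)^(q+1),
        (of ABX.x) * (of ABX.b)^(q-(s-1)) * (of ABX.x) * ((of ABX.b)^(q+s-1) * (of ABX.x))^(k-1))} : Set (Word ABX × Word ABX))) ∧
    IsTerminating (({((of ABX.a)^p * (of ABX.x) * (of ABX.b)^q * (of ABX.x) * (of ABX.b)^(s-1), of ABX.x),
       ((of ABX.a)^p * (of ABX.b), (of ABX.x) * (of ABX.b)^q * (of ABX.x) * ((of ABX.b)^(q+s-1) * (of ABX.x))^(k-2)),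
       ((of ABX.x) * (of ABX.b)^q * (of ABX.x) * ((of ABX.b)^(q+s-1) * (of ABX.x))^(k-1), of ABX.b),
       ((of ABX.x) * (of ABX.b)^q * (of ABX.x) * ((of ABX.b)^(q+s-1) * (of ABX.x))^(k-2) * (of ABX.b)^(q+s),
        (of ABX.b)^(q+1) * (of ABX.x) * ((of ABX.b)^(q+s-1) * (of ABX.x))^(k-1)),
       ((of ABX.a)^p * (of ABX.x) * (of ABX.b)^(q+1),
        (of ABX.x) * (of ABX.b)^(q-(s-1)) * (of ABX.x) * ((of ABX.b)^(q+s-1) * (of ABX.x))^(k-1))} : Set (Word ABX × Word ABX))) ∧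
    Nonempty (MonPres (({((of ABX.a)^p * (of ABX.x) * (of ABX.b)^q * (of ABX.x) * (of ABX.b)^(s-1), of ABX.x),
       ((of ABX.a)^p * (of ABX.b), (of ABX.x) * (of ABX.b)^q * (of ABX.x) * ((of ABX.b)^(q+s-1) * (of ABX.x))^(k-2)),
       ((of ABX.x) * (of ABX.b)^q * (of ABX.x) * ((of ABX.b)^(q+s-1) * (of ABX.x))^(k-1), of ABX.b),
       ((of ABX.x) * (of ABX.b)^q * (of ABX.x) * ((of ABX.b)^(q+s-1) * (of ABX.x))^(k-2) * (of ABX.b)^(q+s),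
        (of ABX.b)^(q+1) * (of ABX.x) * ((of ABX.b)^(q+s-1) * (of ABX.x))^(k-1)),
       ((of ABX.a)^p * (of ABX.x) * (of ABX.b)^(q+1),
        (of ABX.x) * (of ABX.b)^(q-(s-1)) * (of ABX.x) * ((of ABX.b)^(q+s-1) * (of ABX.x))^(k-1))} : Set (Word ABX × Word ABX))) ≃*
      MonPres (({((of AB.a)^p * (of AB.b)^(q+s) * (of AB.a)^(p*k) * (of AB.b)^s, of AB.b)} : Set (Word AB × Word AB)))) := by
  obtain ⟨σ, rfl⟩ := Nat.exists_eq_add_of_le' (Nat.one_le_of_lt hs)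
  obtain ⟨d, rfl⟩ := Nat.exists_eq_add_of_le' hq
  obtain ⟨n, rfl⟩ := Nat.exists_eq_add_of_le' hk
  have hσ : 1 ≤ σ := by omega
  rw [show σ + 1 - 1 = σ by omega, show d + σ + (σ + 1) - 1 = d + σ + σ by omega,
    show n + 2 - 2 = n by omega, show n + 2 - 1 = n + 1 by omega, show d + σ - σ = d by omega,
    ← ruleSet_eq]
  obtain ⟨μ, hμ⟩ := exists_measure_ruleSet (d := d) (n := n) hp hσ
  exact ⟨.of_measure μ hμ (joinable_of_overlaps (joinable_ruleSet hp hσ)), .of_measure μ hμ,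
    nonempty_mulEquiv p σ d n⟩
end

section
/- Let p ≥ 1, s ≥ 2, k ≥ 2, and q ≥ 0 be integers, and let M = Mon⟨a,b : a^p b^{q+s} a^{pk} b^s = b⟩. Writing x for the element of M represented by the word a^{pk} b^s, the equality a^p b = x b^q x (b^{q+s−1} x)^{k−2} holds in M. -/
open Relation FreeMonoid

/-- The defining relation of `M = Mon⟨a,b : a^p b^(q+s) a^(pk) b^s = b⟩`. -/
def relM (p s k q : ℕ) : Set (Word AB × Word AB) :=
  {((of AB.a)^p * (of AB.b)^(q+s) * (of AB.a)^(p*k) * (of AB.b)^s, of AB.b)}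

/-- The element of `M` represented by the generator `a`. -/
def Am (p s k q : ℕ) : MonPres (relM p s k q) := presMk _ (of AB.a)

/-- The element of `M` represented by the generator `b`. -/
def Bm (p s k q : ℕ) : MonPres (relM p s k q) := presMk _ (of AB.b)

/-- The element `x` of `M` represented by the word `a^(pk) b^s`. -/
def Xm (p s k q : ℕ) : MonPres (relM p s k q) := presMk _ ((of AB.a)^(p*k) * (of AB.b)^s)

theorem pow_mul_eq_of_relation {M : Type*} [Monoid M] {c b x : M} {s q n : ℕ} (hs : 1 ≤ s)
    (hx : c ^ (n + 2) * b ^ s = x) (h : c * b ^ (q + s) * x = b) (i j : ℕ) (hij : i + j = n) :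
    c ^ (i + 1) * b = x * b ^ q * x * (b ^ (q + s - 1) * x) ^ j := by
  induction j generalizing i with
  | zero =>
    obtain rfl : i = n := by simpa using hij
    calc c ^ (i + 1) * b = c ^ (i + 1) * (c * b ^ (q + s) * x) := by rw [h]
      _ = c ^ (i + 2) * b ^ s * b ^ q * x := by
        rw [pow_succ c (i + 1), add_comm q s, pow_add b s q]
        simp only [mul_assoc]
      _ = x * b ^ q * x * (b ^ (q + s - 1) * x) ^ 0 := by rw [hx, pow_zero, mul_one]
  | succ j ih =>
    have hb : b * b ^ (q + s - 1) = b ^ (q + s) := mul_pow_sub_one (by omega) b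
    calc c ^ (i + 1) * b = c ^ (i + 1) * (c * b ^ (q + s) * x) := by rw [h]
      _ = c ^ (i + 1 + 1) * b * (b ^ (q + s - 1) * x) := by
        rw [pow_succ c (i + 1), ← hb]
        simp only [mul_assoc]
      _ = x * b ^ q * x * (b ^ (q + s - 1) * x) ^ (j + 1) := by
        rw [ih (i + 1) (by omega), pow_succ, mul_assoc]

theorem relM_relation (p s k q : ℕ) :
    Am p s k q ^ p * Bm p s k q ^ (q + s) * Xm p s k q = Bm p s k q := by
  have h : presMk (relM p s k q)
      ((of AB.a)^p * (of AB.b)^(q+s) * (of AB.a)^(p*k) * (of AB.b)^s) =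
      presMk (relM p s k q) (of AB.b) :=
    (Con.eq _).2 (ConGen.Rel.of _ _ rfl)
  simpa only [Am, Bm, Xm, map_mul, map_pow, mul_assoc] using h

/-- In `M`, the equality `a^p b = x b^q x (b^(q+s-1) x)^(k-2)` holds. -/
theorem stmt8 (p s k q : ℕ) (hp : 1 ≤ p) (hs : 2 ≤ s) (hk : 2 ≤ k) :
    (Am p s k q)^p * (Bm p s k q) = (Xm p s k q) * (Bm p s k q)^q * (Xm p s k q) * ((Bm p s k q)^(q+s-1) * (Xm p s k q))^(k-2) := by
  obtain ⟨n, rfl⟩ := Nat.exists_eq_add_of_le' hk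
  have hx : (Am p s (n + 2) q ^ p) ^ (n + 2) * Bm p s (n + 2) q ^ s = Xm p s (n + 2) q := by
    simp only [Am, Bm, Xm, map_mul, map_pow, ← pow_mul]
  simpa using pow_mul_eq_of_relation (by omega) hx (relM_relation p s (n + 2) q) 0 n (by omega)
end

section
/- Let p ≥ 1, s ≥ 2, k ≥ 2, and q ≥ 0 be integers, and let M = Mon⟨a,b : a^p b^{q+s} a^{pk} b^s = b⟩. Writing x for the element of M represented by the word a^{pk} b^s, the equality b = x b^q x (b^{q+s−1} x)^{k−1} holds in M. -/
open Relation FreeMonoid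

/-- If `c * b^(q+s) * x = b` with `x = c^k * b^s`, then `c^i * b` can be written in terms of `b`
and `x` alone. -/
theorem pow_mul_eq_of_mul_eq {M : Type*} [Monoid M] {c b x : M} {s k q : ℕ} (hs : 1 ≤ s)
    (hx : x = c ^ k * b ^ s) (hb : c * b ^ (q + s) * x = b) (i j : ℕ) (hij : i + j + 1 = k) :
    c ^ i * b = x * b ^ q * x * (b ^ (q + s - 1) * x) ^ j := by
  induction j generalizing i with
  | zero =>
    calc c ^ i * b = c ^ i * (c * b ^ (q + s) * x) := by rw [hb]
      _ = c ^ (i + 1) * b ^ s * b ^ q * x := by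
        rw [add_comm q s, pow_add b, pow_succ c]
        simp only [mul_assoc]
      _ = _ := by
        rw [show i + 1 = k by omega, ← hx, pow_zero, mul_one]
  | succ j ih =>
    calc c ^ i * b = c ^ i * (c * b ^ (q + s) * x) := by rw [hb]
      _ = c ^ (i + 1) * b * (b ^ (q + s - 1) * x) := by
        rw [show q + s = (q + s - 1) + 1 by omega, pow_succ' b, pow_succ c, Nat.add_sub_cancel]
        simp only [mul_assoc]
      _ = _ := by
        rw [ih (i + 1) (by omega), pow_succ, mul_assoc _ (_ ^ j)]

/-- In `M`, the equality `b = x b^q x (b^(q+s-1) x)^(k-1)` holds. -/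
theorem stmt9 (p s k q : ℕ) (hp : 1 ≤ p) (hs : 2 ≤ s) (hk : 2 ≤ k) :
    (Bm p s k q) = (Xm p s k q) * (Bm p s k q)^q * (Xm p s k q) * ((Bm p s k q)^(q+s-1) * (Xm p s k q))^(k-1) := by
  have hx : Xm p s k q = (Am p s k q ^ p) ^ k * Bm p s k q ^ s := by
    simp only [Xm, Am, Bm, map_mul, map_pow, pow_mul]
  have hb : Am p s k q ^ p * Bm p s k q ^ (q + s) * Xm p s k q = Bm p s k q := by
    have h : presMk (relM p s k q) ((of AB.a)^p * (of AB.b)^(q+s) * (of AB.a)^(p*k) * (of AB.b)^s)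
        = presMk (relM p s k q) (of AB.b) :=
      (Con.eq _).2 (ConGen.Rel.of _ _ rfl)
    simpa only [Xm, Am, Bm, map_mul, map_pow, mul_assoc] using h
  simpa only [pow_zero, one_mul] using
    pow_mul_eq_of_mul_eq (by omega) hx hb 0 (k - 1) (by omega)
end

section
/- The rewriting system on the three-letter alphabet {a,b,x} with the four rules a x x b → x, a b → x x, x x b x → b, x x b b → b x b x is confluent and terminating, and the monoid it presents (the quotient of {a,b,x}* by the congruence generated by these rules viewed as relations) is isomorphic to Mon⟨a,b : a b² a² b² = b⟩, via an isomorphism sending a to a, b to b, and x to the element represented by a²b². -/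
open Relation FreeMonoid

/-- The defining relation of `M = Mon⟨a,b : a b² a² b² = b⟩`. -/
def rel0 : Set (Word AB × Word AB) :=
  {((of AB.a) * (of AB.b)^2 * (of AB.a)^2 * (of AB.b)^2, of AB.b)}

/-- The element of `M` represented by the generator `a`. -/
def A0 : MonPres rel0 := presMk _ (of AB.a)

/-- The element of `M` represented by the generator `b`. -/
def B0 : MonPres rel0 := presMk _ (of AB.b)

/-- Newman's lemma: a terminating locally confluent relation is confluent. -/
theorem join_of_wellFounded_of_locally_join {α : Type*} {r : α → α → Prop}
    (wf : WellFounded (flip r))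
    (h : ∀ a b c, r a b → r a c → Join (ReflTransGen r) b c) (a : α) :
    ∀ b c, ReflTransGen r a b → ReflTransGen r a c → Join (ReflTransGen r) b c := by
  induction a using wf.induction with
  | h a ih =>
    intro b c hab hac
    rcases hab.cases_head with rfl | ⟨b', hb', hb⟩
    · exact ⟨c, hac, .refl⟩
    rcases hac.cases_head with rfl | ⟨c', hc', hc⟩
    · exact ⟨b, .refl, hab⟩
    obtain ⟨d, hbd, hcd⟩ := h a b' c' hb' hc'
    obtain ⟨e, hbe, hde⟩ := ih b' hb' b d hb hbd
    obtain ⟨f, hef, hcf⟩ := ih c' hc' e c (hcd.trans hde) hc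
    exact ⟨f, hbe.trans hef, hcf⟩

namespace ABX

/-- The rules `axxb → x`, `ab → xx`, `xxbx → b`, `xxbb → bxbx`. -/
abbrev rules : Set (Word ABX × Word ABX) :=
  {((of ABX.a) * (of ABX.x) * (of ABX.x) * (of ABX.b), of ABX.x),
   ((of ABX.a) * (of ABX.b), (of ABX.x) * (of ABX.x)),
   ((of ABX.x) * (of ABX.x) * (of ABX.b) * (of ABX.x), of ABX.b),
   ((of ABX.x) * (of ABX.x) * (of ABX.b) * (of ABX.b),
    (of ABX.b) * (of ABX.x) * (of ABX.b) * (of ABX.x))}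

/-- The rules as a relation on lists of letters. -/
inductive Rule : List ABX → List ABX → Prop
  | axxb : Rule [a, x, x, b] [x]
  | ab : Rule [a, b] [x, x]
  | xxbx : Rule [x, x, b, x] [b]
  | xxbb : Rule [x, x, b, b] [b, x, b, x]

theorem mem_rules_iff (l r : List ABX) :
    (ofList l, ofList r) ∈ rules ↔ Rule l r := by
  constructor
  · rintro (h | h | h | h) <;> obtain ⟨rfl, rfl⟩ := Prod.mk.inj h
    exacts [.axxb, .ab, .xxbx, .xxbb]
  · rintro (_ | _ | _ | _)
    exacts [.inl rfl, .inr (.inl rfl), .inr (.inr (.inl rfl)), .inr (.inr (.inr rfl))]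

/-- One-step rewriting on lists of letters. -/
def Step (p q : List ABX) : Prop :=
  ∃ u v l r, Rule l r ∧ p = u ++ l ++ v ∧ q = u ++ r ++ v

theorem oneStep_iff (p q : List ABX) : OneStep rules (ofList p) (ofList q) ↔ Step p q := by
  constructor
  · rintro ⟨u, v, l, r, h, hp, hq⟩
    exact ⟨u.toList, v.toList, l.toList, r.toList, (mem_rules_iff _ _).1 h, hp, hq⟩
  · rintro ⟨u, v, l, r, h, hp, hq⟩
    exact ⟨ofList u, ofList v, ofList l, ofList r, (mem_rules_iff _ _).2 h, hp, hq⟩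

theorem oneStep_eq : (OneStep rules : List ABX → List ABX → Prop) = Step := by
  ext p q
  exact oneStep_iff p q

theorem Rule.step {l r : List ABX} (h : Rule l r) (u v : List ABX) :
    Step (u ++ l ++ v) (u ++ r ++ v) :=
  ⟨u, v, l, r, h, rfl, rfl⟩

theorem Step.append_left {p q : List ABX} (h : Step p q) (w : List ABX) :
    Step (w ++ p) (w ++ q) := by
  obtain ⟨u, v, l, r, h, rfl, rfl⟩ := h
  exact ⟨w ++ u, v, l, r, h, by simp, by simp⟩

/-- A strictly monotone interpretation of letters which decreases along every rule. -/
def interp : ABX → ℕ → ℕ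
  | a, n => 4 * n
  | b, n => n + 1
  | x, n => 2 * n

/-- The weight of a word, obtained by composing the interpretations of its letters. -/
def weight (w : List ABX) (n : ℕ) : ℕ := w.foldr interp n

theorem weight_append (u v : List ABX) (n : ℕ) : weight (u ++ v) n = weight u (weight v n) := by
  simp [weight]

theorem weight_strictMono (u : List ABX) : StrictMono (weight u) := by
  intro m n h
  induction u with
  | nil => exact h
  | cons c u ih => cases c <;> simp only [weight, List.foldr_cons, interp] at ih ⊢ <;> omega

theorem Rule.weight_lt {l r : List ABX} (h : Rule l r) (n : ℕ) : weight r n < weight l n := by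
  cases h <;> simp only [weight, List.foldr_cons, List.foldr_nil, interp] <;> omega

theorem Step.weight_lt {p q : List ABX} (h : Step p q) : weight q 0 < weight p 0 := by
  obtain ⟨u, v, l, r, h, rfl, rfl⟩ := h
  simp only [weight_append]
  exact weight_strictMono u (h.weight_lt _)

theorem wellFounded_flip_step : WellFounded (flip Step) :=
  Subrelation.wf (fun h => Step.weight_lt h) (measure fun w => weight w 0).wf

theorem join_of_overlap {l r l' r' s v v' : List ABX} (h : Rule l r) (h' : Rule l' r')
    (e : l ++ v = s ++ l' ++ v') :
    Join (ReflTransGen Step) (r ++ v) (s ++ r' ++ v') := by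
  have disjoint (t : List ABX) (hv : v = t ++ l' ++ v') (hs : s = l ++ t) :
      Join (ReflTransGen Step) (r ++ v) (s ++ r' ++ v') := by
    subst hv hs
    refine ⟨r ++ t ++ r' ++ v', .single ?_, .single ?_⟩
    · simpa using h'.step (r ++ t) v'
    · simpa using h.step [] (t ++ r' ++ v')
  have axxbx (w : List ABX) : Join (ReflTransGen Step) (x :: x :: w) (a :: b :: w) :=
    ⟨x :: x :: w, .refl, .single (Rule.ab.step [] w)⟩
  have axxbb (w : List ABX) : Join (ReflTransGen Step) (x :: b :: w) (a :: b :: x :: b :: x :: w) :=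
    ⟨x :: b :: w, .refl, .head (Rule.ab.step [] _) (.single (Rule.xxbx.step [x] w))⟩
  have xxbxxbx (w : List ABX) :
      Join (ReflTransGen Step) (b :: x :: b :: x :: w) (x :: x :: b :: b :: w) :=
    ⟨b :: x :: b :: x :: w, .refl, .single (Rule.xxbb.step [] w)⟩
  have xxbxxbb (w : List ABX) :
      Join (ReflTransGen Step) (b :: x :: b :: b :: w) (x :: x :: b :: b :: x :: b :: x :: w) :=
    ⟨b :: x :: b :: b :: w, .refl, .head (Rule.xxbb.step [] _)
      (.single (Rule.xxbx.step [b, x, b] w))⟩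
  rcases s with _ | ⟨s₁, _ | ⟨s₂, _ | ⟨s₃, _ | ⟨s₄, s⟩⟩⟩⟩ <;> cases h <;> cases h' <;>
    simp only [List.cons_append, List.nil_append, List.cons.injEq, reduceCtorEq, false_and,
      and_false, true_and] at e
  all_goals
    try casesm* _ ∧ _
    subst_vars
    first
    | exact ⟨_, .refl, .refl⟩
    | exact axxbx _
    | exact axxbb _
    | exact xxbxxbx _
    | exact xxbxxbb _
    | exact disjoint _ (by simp) rfl

theorem join_of_step {p q q' : List ABX} (h : Step p q) (h' : Step p q') :
    Join (ReflTransGen Step) q q' := by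
  obtain ⟨u, v, l, r, h, rfl, rfl⟩ := h
  obtain ⟨u', v', l', r', h', e, rfl⟩ := h'
  have lift {m m' : List ABX} (w : List ABX) :
      Join (ReflTransGen Step) m m' → Join (ReflTransGen Step) (w ++ m) (w ++ m') := by
    rintro ⟨z, hz, hz'⟩
    exact ⟨w ++ z, hz.lift _ fun _ _ h => h.append_left w, hz'.lift _ fun _ _ h => h.append_left w⟩
  rw [List.append_assoc, List.append_assoc, List.append_eq_append_iff] at e
  rcases e with ⟨s, rfl, e⟩ | ⟨s, rfl, e⟩
  · simpa using lift u (join_of_overlap h h' (by simpa using e))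
  · simpa using lift u' ((Std.Symm.symm _ _ (join_of_overlap h' h (by simpa using e))))

theorem isConfluent_rules : IsConfluent rules := by
  have key := join_of_wellFounded_of_locally_join wellFounded_flip_step
    fun _ _ _ => join_of_step
  rw [← oneStep_eq] at key
  exact key

theorem isTerminating_rules : IsTerminating rules := by
  rintro ⟨f, hf⟩
  exact (wellFounded_iff_isEmpty_descending_chain.1 wellFounded_flip_step).false
    ⟨fun n => (f n).toList, fun n => (oneStep_iff _ _).1 (hf n)⟩

theorem presMk_eq_of_mem {A : Type} {R : Set (Word A × Word A)} {l r : Word A}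
    (h : (l, r) ∈ R) : presMk R l = presMk R r :=
  (Con.eq _).2 (ConGen.Rel.of _ _ h)

theorem A0_B0_rel : A0 * B0 ^ 2 * A0 ^ 2 * B0 ^ 2 = B0 := by
  simpa [A0, B0] using presMk_eq_of_mem (R := rel0) rfl

/-- The images of the generators in `Mon⟨a,b : a b² a² b² = b⟩`. -/
def genImage : ABX → MonPres rel0
  | a => A0
  | b => B0
  | x => A0 ^ 2 * B0 ^ 2

theorem rules_hold_of_eq {M : Type*} [Monoid M] {α β ξ : M} (hξ : ξ = α ^ 2 * β ^ 2)
    (h : α * β ^ 2 * ξ = β) :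
    α * ξ * ξ * β = ξ ∧ α * β = ξ * ξ ∧ ξ * ξ * β * ξ = β ∧ ξ * ξ * β * β = β * ξ * β * ξ := by
  have hsq : ξ * ξ = α * β := by
    calc ξ * ξ = α * (α * β ^ 2 * ξ) := by nth_rewrite 1 [hξ]; simp only [sq, mul_assoc]
      _ = α * β := by rw [h]
  have hbx : ξ * ξ * β * ξ = β := by
    rw [hsq, mul_assoc α, ← sq, h]
  refine ⟨?_, hsq.symm, hbx, ?_⟩
  · rw [mul_assoc α, hsq, hξ]
    simp only [sq, mul_assoc]
  · calc ξ * ξ * β * β = α * β ^ 2 * (ξ * ξ * β * ξ) := by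
          rw [hbx, hsq]; simp only [sq, mul_assoc]
      _ = α * β ^ 2 * ξ * ξ * β * ξ := by simp only [mul_assoc]
      _ = β * ξ * β * ξ := by rw [h]

theorem conGen_rules_le :
    conGen (fun p q : Word ABX => (p, q) ∈ rules) ≤ Con.ker (FreeMonoid.lift genImage) := by
  have h : A0 * B0 ^ 2 * (A0 ^ 2 * B0 ^ 2) = B0 := by
    simpa only [mul_assoc] using A0_B0_rel
  obtain ⟨h₁, h₂, h₃, h₄⟩ := rules_hold_of_eq rfl h
  refine Con.conGen_le.2 ?_
  rintro p q (h | h | h | h) <;> obtain ⟨rfl, rfl⟩ := Prod.mk.inj h <;>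
    simpa only [Con.ker_rel, map_mul, lift_eval_of, genImage]

/-- The homomorphism `Mon⟨a,b,x : rules⟩ → Mon⟨a,b : a b² a² b² = b⟩`. -/
def toRel0 : MonPres rules →* MonPres rel0 :=
  Con.lift _ (FreeMonoid.lift genImage) conGen_rules_le

theorem toRel0_presMk_of (c : ABX) : toRel0 (presMk _ (of c)) = genImage c :=
  lift_eval_of _ _

/-- The inclusion of letters, as a map into the monoid presented by the rules. -/
def letterImage : AB → MonPres rules
  | AB.a => presMk _ (of a)
  | AB.b => presMk _ (of b)

theorem letterImage_a_sq_mul_b_sq :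
    letterImage AB.a ^ 2 * letterImage AB.b ^ 2 = presMk rules (of x) := by
  have h₁ := presMk_eq_of_mem ((mem_rules_iff _ _).2 Rule.axxb)
  have h₂ := presMk_eq_of_mem ((mem_rules_iff _ _).2 Rule.ab)
  simp only [ofList_cons, ofList_nil, mul_one, map_mul] at h₁ h₂
  rw [← mul_assoc (presMk rules (of x)), ← h₂] at h₁
  simpa only [letterImage, sq, mul_assoc] using h₁

theorem conGen_rel0_le :
    conGen (fun p q : Word AB => (p, q) ∈ rel0) ≤ Con.ker (FreeMonoid.lift letterImage) := by
  refine Con.conGen_le.2 ?_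
  rintro p q h
  obtain ⟨rfl, rfl⟩ := Prod.mk.inj h
  have h₂ := presMk_eq_of_mem ((mem_rules_iff _ _).2 Rule.ab)
  have h₃ := presMk_eq_of_mem ((mem_rules_iff _ _).2 Rule.xxbx)
  simp only [ofList_cons, ofList_nil, mul_one, map_mul] at h₂ h₃
  rw [← mul_assoc (presMk rules (of x)), ← h₂] at h₃
  simp only [Con.ker_rel, map_mul, map_pow, lift_eval_of]
  rw [mul_assoc _ (letterImage AB.a ^ 2), letterImage_a_sq_mul_b_sq]
  simpa only [letterImage, sq, mul_assoc] using h₃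

/-- The homomorphism `Mon⟨a,b : a b² a² b² = b⟩ → Mon⟨a,b,x : rules⟩`. -/
def ofRel0 : MonPres rel0 →* MonPres rules :=
  Con.lift _ (FreeMonoid.lift letterImage) conGen_rel0_le

theorem ofRel0_presMk_of (c : AB) : ofRel0 (presMk _ (of c)) = letterImage c :=
  lift_eval_of _ _

theorem MonPres.hom_ext {A : Type} {R : Set (Word A × Word A)} {M : Type*} [Monoid M]
    {f g : MonPres R →* M} (h : ∀ c, f (presMk R (of c)) = g (presMk R (of c))) : f = g :=
  Con.lift_funext f g fun w =>
    DFunLike.congr_fun (FreeMonoid.hom_eq (f := f.comp (presMk R)) (g := g.comp (presMk R)) h) w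

/-- The isomorphism `Mon⟨a,b,x : rules⟩ ≃* Mon⟨a,b : a b² a² b² = b⟩`. -/
def equivRel0 : MonPres rules ≃* MonPres rel0 :=
  toRel0.toMulEquiv ofRel0
    (MonPres.hom_ext fun c => by
      have ha : ofRel0 A0 = letterImage AB.a := ofRel0_presMk_of _
      have hb : ofRel0 B0 = letterImage AB.b := ofRel0_presMk_of _
      rw [MonoidHom.comp_apply, toRel0_presMk_of, MonoidHom.id_apply]
      cases c
      · exact ha
      · exact hb
      · rw [genImage, map_mul, map_pow, map_pow, ha, hb, letterImage_a_sq_mul_b_sq])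
    (MonPres.hom_ext fun c => by
      rw [MonoidHom.comp_apply, ofRel0_presMk_of, MonoidHom.id_apply]
      cases c <;> exact toRel0_presMk_of _)

end ABX

/-- The four-rule system `axxb → x`, `ab → xx`, `xxbx → b`, `xxbb → bxbx` on `{a,b,x}`
is complete and presents `Mon⟨a,b : a b² a² b² = b⟩` via `a ↦ a`, `b ↦ b`, `x ↦ a²b²`. -/
theorem stmt12 :
    IsConfluent (({((of ABX.a) * (of ABX.x) * (of ABX.x) * (of ABX.b), of ABX.x),
       ((of ABX.a) * (of ABX.b), (of ABX.x) * (of ABX.x)),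
       ((of ABX.x) * (of ABX.x) * (of ABX.b) * (of ABX.x), of ABX.b),
       ((of ABX.x) * (of ABX.x) * (of ABX.b) * (of ABX.b), (of ABX.b) * (of ABX.x) * (of ABX.b) * (of ABX.x))} : Set (Word ABX × Word ABX))) ∧
    IsTerminating (({((of ABX.a) * (of ABX.x) * (of ABX.x) * (of ABX.b), of ABX.x),
       ((of ABX.a) * (of ABX.b), (of ABX.x) * (of ABX.x)),
       ((of ABX.x) * (of ABX.x) * (of ABX.b) * (of ABX.x), of ABX.b),
       ((of ABX.x) * (of ABX.x) * (of ABX.b) * (of ABX.b), (of ABX.b) * (of ABX.x) * (of ABX.b) * (of ABX.x))} : Set (Word ABX × Word ABX))) ∧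
    ∃ e : MonPres (({((of ABX.a) * (of ABX.x) * (of ABX.x) * (of ABX.b), of ABX.x),
       ((of ABX.a) * (of ABX.b), (of ABX.x) * (of ABX.x)),
       ((of ABX.x) * (of ABX.x) * (of ABX.b) * (of ABX.x), of ABX.b),
       ((of ABX.x) * (of ABX.x) * (of ABX.b) * (of ABX.b), (of ABX.b) * (of ABX.x) * (of ABX.b) * (of ABX.x))} : Set (Word ABX × Word ABX))) ≃* MonPres rel0,
      e (presMk _ (of ABX.a)) = A0 ∧ e (presMk _ (of ABX.b)) = B0 ∧
      e (presMk _ (of ABX.x)) = A0^2 * B0^2 := by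
  refine ⟨ABX.isConfluent_rules, ABX.isTerminating_rules, ABX.equivRel0,
    ABX.toRel0_presMk_of .a, ABX.toRel0_presMk_of .b, ABX.toRel0_presMk_of .x⟩
end

section
/- In the monoid M = Mon⟨a,b : a b² a² b² = b⟩, the equality a·(bab)²·a²·(bab)² = bab holds; consequently, the assignment a ↦ a, b ↦ bab extends to a (unique) monoid endomorphism φ of M with φ(a) = a and φ(b) = bab. -/
open Relation FreeMonoid

/-- The two ways of reducing `a b² a² b² a² b²`. -/
theorem critical_pair {M : Type*} [Monoid M] {a b : M}
    (h : a * b ^ 2 * a ^ 2 * b ^ 2 = b) : a * b ^ 2 * a * b = b * a ^ 2 * b ^ 2 := by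
  calc a * b ^ 2 * a * b = a * b ^ 2 * a * (a * b ^ 2 * a ^ 2 * b ^ 2) := by rw [h]
    _ = (a * b ^ 2 * a ^ 2 * b ^ 2) * a ^ 2 * b ^ 2 := by simp only [pow_two, mul_assoc]
    _ = b * a ^ 2 * b ^ 2 := by rw [h]

/-- If `a, b` satisfy the relation `a b² a² b² = b`, then so do `a, bab`. -/
theorem relation_conj {M : Type*} [Monoid M] {a b : M} (h : a * b ^ 2 * a ^ 2 * b ^ 2 = b) :
    a * (b * a * b) ^ 2 * a ^ 2 * (b * a * b) ^ 2 = b * a * b := by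
  calc a * (b * a * b) ^ 2 * a ^ 2 * (b * a * b) ^ 2
      = a * b * (a * b ^ 2 * a * b) * a ^ 2 * b * (a * b ^ 2 * a * b) := by
        simp only [pow_two, mul_assoc]
    _ = a * b * (b * a ^ 2 * b ^ 2) * a ^ 2 * b * (b * a ^ 2 * b ^ 2) := by
        rw [critical_pair h]
    _ = (a * b ^ 2 * a ^ 2 * b ^ 2) * a ^ 2 * b * (b * a ^ 2 * b ^ 2) := by
        simp only [pow_two, mul_assoc]
    _ = b * a ^ 2 * b * (b * a ^ 2 * b ^ 2) := by rw [h]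
    _ = b * a * (a * b ^ 2 * a ^ 2 * b ^ 2) := by simp only [pow_two, mul_assoc]
    _ = b * a * b := by rw [h]

/-- The defining relation holds between the generators of `M`. -/
theorem A0_B0_relation : A0 * B0 ^ 2 * A0 ^ 2 * B0 ^ 2 = B0 := by
  have h : presMk rel0 (of AB.a * of AB.b ^ 2 * of AB.a ^ 2 * of AB.b ^ 2) =
      presMk rel0 (of AB.b) :=
    (Con.eq _).2 (ConGen.Rel.of _ _ rfl)
  rwa [map_mul, map_mul, map_mul, map_pow, map_pow] at h

/-- Homomorphisms out of `M` are determined by their values on the generators. -/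
theorem hom_ext_A0_B0 {N : Type*} [Monoid N] {f g : MonPres rel0 →* N}
    (ha : f A0 = g A0) (hb : f B0 = g B0) : f = g := by
  apply Con.lift_funext
  have h : f.comp (presMk rel0) = g.comp (presMk rel0) :=
    FreeMonoid.hom_eq fun x => by
      cases x
      · exact ha
      · exact hb
  exact fun w => DFunLike.congr_fun h w

/-- A pair of elements satisfying the defining relation of `M` is the image of the generators
under a homomorphism. -/
theorem exists_hom_of_relation {N : Type*} [Monoid N] {a b : N}
    (h : a * b ^ 2 * a ^ 2 * b ^ 2 = b) : ∃ f : MonPres rel0 →* N, f A0 = a ∧ f B0 = b := by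
  let F : Word AB →* N := FreeMonoid.lift fun x => AB.casesOn x a b
  have hF : conGen (fun x y : Word AB => (x, y) ∈ rel0) ≤ Con.ker F := by
    refine Con.conGen_le.2 fun x y hxy => ?_
    obtain ⟨rfl, rfl⟩ := Prod.mk.inj hxy
    simpa [F, Con.ker_rel] using h
  exact ⟨Con.lift _ F hF, FreeMonoid.lift_eval_of _ _, FreeMonoid.lift_eval_of _ _⟩

/-- In `M`, `a·(bab)²·a²·(bab)² = bab`, hence `a ↦ a`, `b ↦ bab` extends to a unique
monoid endomorphism of `M`. -/
theorem stmt13 :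
    A0 * (B0 * A0 * B0)^2 * A0^2 * (B0 * A0 * B0)^2 = B0 * A0 * B0 ∧
    ∃! φ : MonPres rel0 →* MonPres rel0, φ A0 = A0 ∧ φ B0 = B0 * A0 * B0 := by
  have h := relation_conj A0_B0_relation
  obtain ⟨φ, ha, hb⟩ := exists_hom_of_relation h
  exact ⟨h, φ, ⟨ha, hb⟩, fun ψ hψ =>
    hom_ext_A0_B0 (hψ.1.trans ha.symm) (hψ.2.trans hb.symm)⟩
end

section
/- Let M = Mon⟨a,b : a b² a² b² = b⟩ and let φ : M → M be the monoid endomorphism determined by φ(a) = a and φ(b) = bab. Then φ is surjective. -/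
open Relation FreeMonoid

/-- The defining relation, read in `M`. -/
theorem A0_B0_rel : A0 * (B0 * (B0 * (A0 * (A0 * (B0 * B0))))) = B0 := by
  have h : presMk rel0 (of AB.a * of AB.b ^ 2 * of AB.a ^ 2 * of AB.b ^ 2) =
      presMk rel0 (of AB.b) :=
    (Con.eq _).2 (ConGen.Rel.of _ _ rfl)
  simp only [map_mul, pow_two, mul_assoc] at h
  exact h

/-- In `M`, resolving the self-overlap of the defining relation gives `b a² b² = a b² a b`. -/
theorem B0_overlap :
    B0 * (A0 * (A0 * (B0 * B0))) = A0 * (B0 * (B0 * (A0 * B0))) := by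
  calc B0 * (A0 * (A0 * (B0 * B0)))
      = A0 * (B0 * (B0 * (A0 * (A0 * (B0 * B0))))) * (A0 * (A0 * (B0 * B0))) := by
        rw [A0_B0_rel]
    _ = A0 * (B0 * (B0 * (A0 * (A0 * (B0 * (B0 * (A0 * (A0 * (B0 * B0))))))))) := by
        simp only [mul_assoc]
    _ = A0 * (B0 * (B0 * (A0 * B0))) := by rw [A0_B0_rel]

/-- In `M`, the generator `b` equals `a (bab)²`. -/
theorem B0_eq : A0 * ((B0 * A0 * B0) * (B0 * A0 * B0)) = B0 := by
  simp only [mul_assoc]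
  rw [← B0_overlap, A0_B0_rel]

/-- The endomorphism of `M` determined by `a ↦ a`, `b ↦ bab` is surjective. -/
theorem stmt15 (φ : MonPres rel0 →* MonPres rel0) (ha : φ A0 = A0)
    (hb : φ B0 = B0 * A0 * B0) : Function.Surjective φ := by
  have hB : φ (A0 * (B0 * B0)) = B0 := by
    rw [map_mul, map_mul, ha, hb, B0_eq]
  rw [← MonoidHom.mrange_eq_top, eq_top_iff]
  rintro m -
  obtain ⟨w, rfl⟩ := Con.mk'_surjective m
  change presMk rel0 w ∈ MonoidHom.mrange φ
  induction w using FreeMonoid.inductionOn' with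
  | one => rw [map_one]; exact one_mem _
  | of_mul x w ih =>
    rw [map_mul]
    refine mul_mem ?_ ih
    cases x with
    | a => exact ⟨A0, ha⟩
    | b => exact ⟨A0 * (B0 * B0), hB⟩
end

section
/- The monoid M = Mon⟨a,b : a b² a² b² = b⟩ has linear Dehn function: there exists a constant C such that for every n and for all words u, v over {a,b} of length at most n that represent the same element of M, there is a derivation u = w₀ ∼ w₁ ∼ ⋯ ∼ w_m = v with m ≤ C·n, where w ∼ w′ means that w′ is obtained from w by a single application of the defining relation (replacing one occurrence of the factor ab²a²b² by b, or one occurrence of the letter b by ab²a²b², inside the word). -/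
open Relation FreeMonoid

/-- A single application of the defining relation `a b² a² b² = b` inside a word. -/
def DehnStep (w w' : Word AB) : Prop :=
  ∃ u₁ u₂ : Word AB,
    (w = u₁ * ((of AB.a) * (of AB.b)^2 * (of AB.a)^2 * (of AB.b)^2) * u₂ ∧ w' = u₁ * of AB.b * u₂) ∨
    (w = u₁ * of AB.b * u₂ ∧ w' = u₁ * ((of AB.a) * (of AB.b)^2 * (of AB.a)^2 * (of AB.b)^2) * u₂)

/-- Weights of the letters in the measure `runSize`. -/
def ABX.weight_s19 : ABX → ℕ
  | .a => 3
  | .b => 1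
  | .x => 1

/-- The measure that decreases along the recursion of `run`; letters that are still to be read
count one more than those already read. -/
def runSize (s l : List ABX) : ℕ := (s.map ABX.weight_s19).sum + (l.map fun c => c.weight_s19 + 1).sum

/-- The complete rewriting system behind `run`: with `x = aabb`, the rules are
`ab → xx`, `axxb → x`, `xxbx → b` and `xxbb → bxbx`. `run s l` reads `l` letter by letter onto the
irreducible word `s` (stored with its last letter first), rewriting whenever a rule applies.
The fourth rule is merged with the third one when it creates a new occurrence of `xxbx`. -/
def run : List ABX → List ABX → List ABX
  | s, [] => s
  | s, .a :: l => run (.a :: s) l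
  | .b :: .x :: .x :: s, .x :: l => run s (.b :: l)
  | s, .x :: l => run (.x :: s) l
  | .a :: s, .b :: l => run s (.x :: .x :: l)
  | .x :: .x :: .a :: s, .b :: l => run s (.x :: l)
  | .b :: .x :: .x :: .x :: .x :: s, .b :: l => run s (.b :: .b :: .x :: l)
  | .b :: .x :: .x :: s, .b :: l => run (.x :: .b :: .x :: .b :: s) l
  | s, .b :: l => run (.b :: s) l
termination_by s l => runSize s l
decreasing_by all_goals simp +arith [runSize, ABX.weight_s19]

/-- `Allowed c s`: appending `c` to the irreducible reversed word `s` creates no redex. -/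
def Allowed : ABX → List ABX → Prop
  | .b, .a :: _ => False
  | .b, .x :: .x :: .a :: _ => False
  | .b, .b :: .x :: .x :: _ => False
  | .x, .b :: .x :: .x :: _ => False
  | _, _ => True

/-- Irreducibility of a reversed word for the rewriting system described at `run`. -/
def Irr : List ABX → Prop
  | [] => True
  | c :: s => Allowed c s ∧ Irr s

theorem irr_run (s l : List ABX) (h : Irr s) : Irr (run s l) := by
  fun_induction run s l
  case case8 s l _ ih =>
    refine ih ?_
    rcases s with _ | ⟨_ | _ | _, _ | ⟨_ | _ | _, _ | ⟨_ | _ | _, s⟩⟩⟩ <;>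
      simp_all [Irr, Allowed]
  all_goals simp_all [Irr, Allowed]

theorem run_append (s l l' : List ABX) : run s (l ++ l') = run (run s l) l' := by
  fun_induction run s l <;> simp_all [run]

theorem run_aabb (s l : List ABX) : run s (.a :: .a :: .b :: .b :: l) = run s (.x :: l) := by
  simp [run]

theorem run_xxbx (s l : List ABX) (h : Irr s) :
    run s (.x :: .x :: .b :: .x :: l) = run s (.b :: l) := by
  rcases s with _ | ⟨_ | _ | _, _ | ⟨_ | _ | _, _ | ⟨_ | _ | _, _ | ⟨_ | _ | _,
    _ | ⟨_ | _ | _, s⟩⟩⟩⟩⟩ <;> simp_all [run, Irr, Allowed]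
  all_goals
    rcases s with _ | ⟨_ | _ | _, _ | ⟨_ | _ | _, s⟩⟩ <;> simp_all [run]

theorem run_relator (s : List ABX) (h : Irr s) :
    run s [.a, .b, .b, .a, .a, .b, .b] = run s [.b] := by
  rw [← run_xxbx s [] h, show run s [.a, .b, .b, .a, .a, .b, .b] =
    run s ([.x, .x, .b] ++ [.a, .a, .b, .b]) by simp [run], run_append, run_aabb, ← run_append]
  rfl

/-- The inclusion of the alphabet `{a, b}` into `{a, b, x}`. -/
def AB.toABX : AB → ABX
  | .a => .a
  | .b => .b

/-- Two words over `{a, b}` are congruent if they act equally on irreducible words. -/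
def runCon : Con (Word AB) where
  r u v := ∀ s, Irr s → run s (u.toList.map AB.toABX) = run s (v.toList.map AB.toABX)
  iseqv := ⟨fun _ _ _ => rfl, fun h s hs => (h s hs).symm,
    fun h h' s hs => (h s hs).trans (h' s hs)⟩
  mul' := fun {u v u' v'} h h' s hs => by
    simp only [toList_mul, List.map_append, run_append]
    rw [h s hs, h' _ (irr_run _ _ hs)]

theorem run_eq_of_presMk_eq {u v : Word AB} (h : presMk rel0 u = presMk rel0 v) :
    run [] (u.toList.map AB.toABX) = run [] (v.toList.map AB.toABX) := by
  have hle : (conGen fun x y : Word AB => (x, y) ∈ rel0) ≤ runCon := by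
    refine Con.conGen_le.2 fun x y hxy s hs => ?_
    obtain ⟨rfl, rfl⟩ := Prod.mk.inj (Set.mem_singleton_iff.1 hxy)
    exact run_relator s hs
  exact hle ((Con.eq _).1 h) [] trivial

/-- `DehnJoined m u v`: the words `u` and `v` are connected by at most `m` elementary steps. -/
inductive DehnJoined : ℕ → Word AB → Word AB → Prop
  | refl (m : ℕ) (u : Word AB) : DehnJoined m u u
  | tail {m : ℕ} {u v w : Word AB} : DehnJoined m u v → DehnStep v w → DehnJoined (m + 1) u w

theorem DehnStep.symm {u v : Word AB} (h : DehnStep u v) : DehnStep v u := by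
  obtain ⟨p, q, h⟩ := h
  exact ⟨p, q, h.symm.imp And.symm And.symm⟩

theorem DehnStep.mul {u v : Word AB} (h : DehnStep u v) (p q : Word AB) :
    DehnStep (p * u * q) (p * v * q) := by
  obtain ⟨p', q', h⟩ := h
  refine ⟨p * p', q' * q, ?_⟩
  rcases h with ⟨rfl, rfl⟩ | ⟨rfl, rfl⟩ <;> simp [mul_assoc]

namespace DehnJoined

theorem mono {m k : ℕ} {u v : Word AB} (h : DehnJoined m u v) (hmk : m ≤ k) : DehnJoined k u v := by
  induction h generalizing k with
  | refl m u => exact .refl k u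
  | tail _ hs ih =>
    obtain ⟨k, rfl⟩ := Nat.exists_eq_add_of_le' hmk
    exact (ih (k := k + _) (by omega)).tail hs

theorem trans {m k : ℕ} {u v w : Word AB} (h : DehnJoined m u v) (h' : DehnJoined k v w) :
    DehnJoined (m + k) u w := by
  induction h' with
  | refl k v => exact h.mono (by omega)
  | tail _ hs ih => exact (ih h).tail hs

theorem single {u v : Word AB} (h : DehnStep u v) : DehnJoined 1 u v := (refl 0 u).tail h

theorem symm {m : ℕ} {u v : Word AB} (h : DehnJoined m u v) : DehnJoined m v u := by
  induction h with
  | refl m u => exact .refl m u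
  | tail _ hs ih => exact ((single hs.symm).trans ih).mono (by omega)

theorem mul {m : ℕ} {u v : Word AB} (h : DehnJoined m u v) (p q : Word AB) :
    DehnJoined m (p * u * q) (p * v * q) := by
  induction h with
  | refl m u => exact .refl m _
  | tail _ hs ih => exact ih.tail (hs.mul p q)

theorem exists_seq {m : ℕ} {u v : Word AB} (h : DehnJoined m u v) :
    ∃ (k : ℕ) (w : ℕ → Word AB), k ≤ m ∧ w 0 = u ∧ w k = v ∧
      ∀ i < k, DehnStep (w i) (w (i + 1)) := by
  induction h with
  | refl m u => exact ⟨0, fun _ => u, by simp⟩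
  | @tail m u v v' _ hs ih =>
    obtain ⟨k, w, hk, h0, hv, hw⟩ := ih
    refine ⟨k + 1, fun i => if i ≤ k then w i else v', by omega, by simpa, by simp, fun i hi => ?_⟩
    rcases (Nat.lt_succ_iff.1 hi).lt_or_eq with hik | rfl
    · simpa [hik.le, Nat.succ_le_of_lt hik] using hw i hik
    · simpa [hv] using hs

end DehnJoined

/-- The word over `{a, b}` represented by a letter, where `x` stands for `aabb`. -/
def ABX.word : ABX → Word AB
  | .a => of .a
  | .b => of .b
  | .x => of .a * of .a * of .b * of .b

/-- The word over `{a, b}` represented by a word over `{a, b, x}`. -/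
def expand (l : List ABX) : Word AB := (l.map ABX.word).prod

theorem expand_append (l l' : List ABX) : expand (l ++ l') = expand l * expand l' := by
  simp [expand]

theorem expand_toABX (u : Word AB) : expand (u.toList.map AB.toABX) = u := by
  induction u using FreeMonoid.inductionOn' with
  | one => rfl
  | of_mul c u hu => cases c <;> exact congrArg (_ * ·) hu

theorem joined_relator : DehnJoined 1 (expand [.a, .b, .b, .a, .a, .b, .b]) (expand [.b]) :=
  .single ⟨1, 1, .inl ⟨rfl, rfl⟩⟩

theorem DehnJoined.context {m : ℕ} {l l' : List ABX} (h : DehnJoined m (expand l) (expand l'))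
    (s t : List ABX) : DehnJoined m (expand (s ++ l ++ t)) (expand (s ++ l' ++ t)) := by
  simpa only [expand_append] using h.mul (expand s) (expand t)

theorem joined_ab : DehnJoined 1 (expand [.a, .b]) (expand [.x, .x]) :=
  joined_relator.symm.context [.a] []

theorem joined_axxb : DehnJoined 1 (expand [.a, .x, .x, .b]) (expand [.x]) :=
  joined_relator.context [.a, .a] [.b]

theorem joined_xxbx : DehnJoined 2 (expand [.x, .x, .b, .x]) (expand [.b]) :=
  (joined_ab.symm.context [] [.b, .x]).trans joined_relator

theorem joined_baabb : DehnJoined 2 (expand [.b, .a, .a, .b, .b]) (expand [.a, .b, .b, .a, .b]) :=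
  (joined_relator.symm.context [] [.a, .a, .b, .b]).trans
    (joined_relator.context [.a, .b, .b, .a] [])

theorem joined_ababbab : DehnJoined 3 (expand [.a, .b, .a, .b, .b, .a, .b]) (expand [.b]) :=
  (joined_baabb.symm.context [.a, .b] []).trans joined_relator

theorem joined_xxbb : DehnJoined 8 (expand [.x, .x, .b, .b]) (expand [.b, .x, .b, .x]) :=
  ((joined_ab.symm.context [] [.b, .b]).trans
    (joined_ababbab.symm.context [.a, .b, .b] [])).trans
    ((joined_baabb.symm.context [.a, .b, .b, .a, .b] []).trans
      (joined_baabb.symm.context [] [.b, .a, .a, .b, .b]))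

theorem joined_xxxxbb : DehnJoined 10 (expand [.x, .x, .x, .x, .b, .b]) (expand [.b, .b, .x]) :=
  (joined_xxbb.context [.x, .x] []).trans (joined_xxbx.context [] [.b, .x])

theorem joined_run (s l : List ABX) :
    DehnJoined (10 * runSize s l) (expand (s.reverse ++ l)) (expand (run s l).reverse) := by
  fun_induction run s l with
  | case1 s => simpa using DehnJoined.refl _ _
  | case2 s l ih | case4 s l _ ih | case9 s l _ _ _ _ ih =>
    rw [List.reverse_cons, List.append_assoc] at ih
    exact ih.mono (by simp [runSize, ABX.weight_s19]; omega)
  | case3 s l ih =>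
    rw [List.append_cons] at ih
    have h := (joined_xxbx.context s.reverse l).trans ih
    refine DehnJoined.mono (by simpa using h) ?_
    simp [runSize, ABX.weight_s19]; omega
  | case5 s l ih =>
    have h := (joined_ab.context s.reverse l).trans (by simpa using ih)
    refine DehnJoined.mono (by simpa using h) ?_
    simp [runSize, ABX.weight_s19]; omega
  | case6 s l ih =>
    have h := (joined_axxb.context s.reverse l).trans (by simpa using ih)
    refine DehnJoined.mono (by simpa using h) ?_
    simp [runSize, ABX.weight_s19]; omega
  | case7 s l ih =>
    have h := (joined_xxxxbb.context s.reverse l).trans (by simpa using ih)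
    refine DehnJoined.mono (by simpa using h) ?_
    simp [runSize, ABX.weight_s19]; omega
  | case8 s l _ ih =>
    have h := (joined_xxbb.context s.reverse l).trans (by simpa using ih)
    refine DehnJoined.mono (by simpa using h) ?_
    simp [runSize, ABX.weight_s19]; omega

theorem joined_run_nil (u : Word AB) :
    DehnJoined (40 * u.length) u (expand (run [] (u.toList.map AB.toABX)).reverse) := by
  have h := joined_run [] (u.toList.map AB.toABX)
  rw [List.reverse_nil, List.nil_append, expand_toABX] at h
  refine h.mono ?_
  have hw : ∀ c : ABX, c.weight_s19 + 1 ≤ 4 := by rintro (_ | _ | _) <;> decide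
  have hs := List.sum_le_card_nsmul ((u.toList.map AB.toABX).map fun c => c.weight_s19 + 1) 4
    (by simpa using fun (c : AB) _ => hw c.toABX)
  have hl : u.toList.length = u.length := rfl
  simp only [List.length_map, smul_eq_mul, hl] at hs
  simp only [runSize, List.map_nil, List.sum_nil]
  omega

/-- `M = Mon⟨a,b : a b² a² b² = b⟩` has linear Dehn function: there is a constant `C` such
that any two words of length at most `n` representing the same element of `M` are connected
by a derivation of at most `C·n` elementary steps. -/
theorem stmt19 :
    ∃ C : ℕ, ∀ (n : ℕ) (u v : Word AB), u.length ≤ n → v.length ≤ n →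
      presMk rel0 u = presMk rel0 v →
      ∃ (m : ℕ) (w : ℕ → Word AB), m ≤ C * n ∧ w 0 = u ∧ w m = v ∧
        ∀ i < m, DehnStep (w i) (w (i + 1)) := by
  refine ⟨80, fun n u v hu hv h => ?_⟩
  have hj := (joined_run_nil u).trans (run_eq_of_presMk_eq h ▸ (joined_run_nil v).symm)
  exact (hj.mono (by omega)).exists_seq
end
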